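/- arXiv:1507.03862 — 3 statements merged into one kernel-verified Lean document; each statement's English description precedes it below -/
import Mathlib

section
/- Let 𝒳 be a full additive subcategory of an abelian category 𝒜, let X• be a bounded-above complex with components in 𝒳, and let f : A• → X• be a right 𝒳-quasi-isomorphism (i.e., Hom(X, f) is a quasi-isomorphism for every X ∈ 𝒳). Then there exists a cochain map g : X• → A• such that f ∘ g is homotopic to the identity of X•. -/
open CategoryTheory Limits

universe v u

variable {A : Type u} [Category.{v} A] [Abelian A]

/-- `Hom(X, -)` for `X ∈ 𝒳` carries the short complex `S` to a short exact
sequence of abelian groups. -/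
def SESRightAcyclic (𝒳 : Set A) (S : ShortComplex A) : Prop :=
  ∀ X ∈ 𝒳,
    (Function.Injective fun h : X ⟶ S.X₁ => h ≫ S.f) ∧
    (∀ h : X ⟶ S.X₂, h ≫ S.g = 0 → ∃ k : X ⟶ S.X₁, k ≫ S.f = h) ∧
    (Function.Surjective fun h : X ⟶ S.X₂ => h ≫ S.g)

/-- `Hom(-, Y)` for `Y ∈ 𝒴` carries the short complex `S` to a short exact
sequence of abelian groups. -/
def SESLeftAcyclic (𝒴 : Set A) (S : ShortComplex A) : Prop :=
  ∀ Y ∈ 𝒴,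
    (Function.Injective fun h : S.X₃ ⟶ Y => S.g ≫ h) ∧
    (∀ h : S.X₂ ⟶ Y, S.f ≫ h = 0 → ∃ k : S.X₃ ⟶ Y, S.g ≫ k = h) ∧
    (Function.Surjective fun h : S.X₂ ⟶ Y => S.f ≫ h)

/-- A `⁎`-acyclic short exact sequence: short exact, right `𝒳`-acyclic and
left `𝒴`-acyclic. -/
def SESStarAcyclic (𝒳 𝒴 : Set A) (S : ShortComplex A) : Prop :=
  S.ShortExact ∧ SESRightAcyclic 𝒳 S ∧ SESLeftAcyclic 𝒴 S

/-- A cochain complex `C` is right `𝒳`-acyclic if `Hom(X, C)` is acyclic for every `X ∈ 𝒳`. -/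
def RightAcyclicComplex (𝒳 : Set A) (C : CochainComplex A ℤ) : Prop :=
  ∀ X ∈ 𝒳, ∀ n : ℤ, ∀ h : X ⟶ C.X n, h ≫ C.d n (n + 1) = 0 →
    ∃ k : X ⟶ C.X (n - 1), k ≫ C.d (n - 1) n = h

/-- A cochain complex `C` is left `𝒴`-acyclic if `Hom(C, Y)` is acyclic for every `Y ∈ 𝒴`. -/
def LeftAcyclicComplex (𝒴 : Set A) (C : CochainComplex A ℤ) : Prop :=
  ∀ Y ∈ 𝒴, ∀ n : ℤ, ∀ h : C.X n ⟶ Y, C.d (n - 1) n ≫ h = 0 →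
    ∃ k : C.X (n + 1) ⟶ Y, C.d n (n + 1) ≫ k = h

/-- `f` is a right `𝒳`-quasi-isomorphism iff its mapping cone is right `𝒳`-acyclic. -/
noncomputable def RightQuasiIso (𝒳 : Set A) {C D : CochainComplex A ℤ} (f : C ⟶ D) : Prop :=
  RightAcyclicComplex 𝒳 (CochainComplex.mappingCone f)

/-- `f` is a `⁎`-quasi-isomorphism: its mapping cone is right `𝒳`-acyclic and left `𝒴`-acyclic. -/
noncomputable def StarQuasiIso (𝒳 𝒴 : Set A) {C D : CochainComplex A ℤ} (f : C ⟶ D) : Prop :=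
  RightAcyclicComplex 𝒳 (CochainComplex.mappingCone f) ∧
    LeftAcyclicComplex 𝒴 (CochainComplex.mappingCone f)

/-- A bounded-above complex with all components in `𝒳`. -/
def MinusComplexIn (𝒳 : Set A) (C : CochainComplex A ℤ) : Prop :=
  (∃ b : ℤ, ∀ i : ℤ, b < i → IsZero (C.X i)) ∧ ∀ i : ℤ, C.X i ∈ 𝒳

/-- A bounded complex. -/
def BoundedComplex (C : CochainComplex A ℤ) : Prop :=
  ∃ a b : ℤ, ∀ i : ℤ, i < a ∨ b < i → IsZero (C.X i)

/-- A proper `𝒳`-resolution `⋯ → P⁻¹ → P⁰ —ε→ M → 0`: the components of `P` in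
nonpositive degrees lie in `𝒳`, the positive components vanish, and the augmented
complex is right `𝒳`-acyclic. -/
def IsProperXResolution (𝒳 : Set A) (M : A) (P : CochainComplex A ℤ) (ε : P.X 0 ⟶ M) : Prop :=
  (∀ i : ℤ, 0 < i → IsZero (P.X i)) ∧ (∀ i : ℤ, i ≤ 0 → P.X i ∈ 𝒳) ∧
  P.d (-1) 0 ≫ ε = 0 ∧
  ∀ X ∈ 𝒳,
    (∀ h : X ⟶ M, ∃ k : X ⟶ P.X 0, k ≫ ε = h) ∧
    (∀ h : X ⟶ P.X 0, h ≫ ε = 0 → ∃ k : X ⟶ P.X (-1), k ≫ P.d (-1) 0 = h) ∧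
    (∀ n : ℤ, n < 0 → ∀ h : X ⟶ P.X n, h ≫ P.d n (n + 1) = 0 →
      ∃ k : X ⟶ P.X (n - 1), k ≫ P.d (n - 1) n = h)

/-- The augmented complex `⋯ → P⁻¹ → P⁰ —ε→ M → 0` is left `𝒴`-acyclic. -/
def AugResLeftAcyclic (𝒴 : Set A) (M : A) (P : CochainComplex A ℤ) (ε : P.X 0 ⟶ M) : Prop :=
  ∀ Y ∈ 𝒴,
    (∀ h : M ⟶ Y, ε ≫ h = 0 → h = 0) ∧
    (∀ h : P.X 0 ⟶ Y, P.d (-1) 0 ≫ h = 0 → ∃ k : M ⟶ Y, ε ≫ k = h) ∧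
    (∀ n : ℤ, n < 0 → ∀ h : P.X n ⟶ Y, P.d (n - 1) n ≫ h = 0 →
      ∃ k : P.X (n + 1) ⟶ Y, P.d n (n + 1) ≫ k = h)

/-- A proper `𝒴`-coresolution `0 → N —η→ Q⁰ → Q¹ → ⋯`. -/
def IsProperYCoresolution (𝒴 : Set A) (N : A) (Q : CochainComplex A ℤ) (η : N ⟶ Q.X 0) : Prop :=
  (∀ i : ℤ, i < 0 → IsZero (Q.X i)) ∧ (∀ i : ℤ, 0 ≤ i → Q.X i ∈ 𝒴) ∧
  η ≫ Q.d 0 1 = 0 ∧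
  ∀ Y ∈ 𝒴,
    (∀ h : N ⟶ Y, ∃ k : Q.X 0 ⟶ Y, η ≫ k = h) ∧
    (∀ h : Q.X 0 ⟶ Y, η ≫ h = 0 → ∃ k : Q.X 1 ⟶ Y, Q.d 0 1 ≫ k = h) ∧
    (∀ n : ℤ, 0 < n → ∀ h : Q.X n ⟶ Y, Q.d (n - 1) n ≫ h = 0 →
      ∃ k : Q.X (n + 1) ⟶ Y, Q.d n (n + 1) ≫ k = h)

/-- The augmented complex `0 → N —η→ Q⁰ → Q¹ → ⋯` is right `𝒳`-acyclic. -/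
def AugCoresRightAcyclic (𝒳 : Set A) (N : A) (Q : CochainComplex A ℤ) (η : N ⟶ Q.X 0) : Prop :=
  ∀ X ∈ 𝒳,
    (∀ h : X ⟶ N, h ≫ η = 0 → h = 0) ∧
    (∀ h : X ⟶ Q.X 0, h ≫ Q.d 0 1 = 0 → ∃ k : X ⟶ N, k ≫ η = h) ∧
    (∀ n : ℤ, 0 < n → ∀ h : X ⟶ Q.X n, h ≫ Q.d n (n + 1) = 0 →
      ∃ k : X ⟶ Q.X (n - 1), k ≫ Q.d (n - 1) n = h)

/-- `f : X ⟶ M` is a right `𝒳`-approximation of `M`. -/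
def IsRightApprox (𝒳 : Set A) {X M : A} (f : X ⟶ M) : Prop :=
  X ∈ 𝒳 ∧ ∀ X' ∈ 𝒳, ∀ g : X' ⟶ M, ∃ h : X' ⟶ X, h ≫ f = g

/-- `f : M ⟶ Y` is a left `𝒴`-approximation of `M`. -/
def IsLeftApprox (𝒴 : Set A) {M Y : A} (f : M ⟶ Y) : Prop :=
  Y ∈ 𝒴 ∧ ∀ Y' ∈ 𝒴, ∀ g : M ⟶ Y', ∃ h : Y ⟶ Y', f ≫ h = g

/-- A minimal (right minimal) right `𝒳`-approximation. -/
def IsMinimalRightApprox (𝒳 : Set A) {X M : A} (f : X ⟶ M) : Prop :=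
  IsRightApprox 𝒳 f ∧ ∀ s : X ⟶ X, s ≫ f = f → IsIso s

/-- A minimal (left minimal) left `𝒴`-approximation. -/
def IsMinimalLeftApprox (𝒴 : Set A) {M Y : A} (f : M ⟶ Y) : Prop :=
  IsLeftApprox 𝒴 f ∧ ∀ s : Y ⟶ Y, f ≫ s = f → IsIso s

/-- `(𝒳, 𝒴)` is a balanced pair: `𝒳` is contravariantly finite, `𝒴` is covariantly
finite, every object has a left `𝒴`-acyclic proper `𝒳`-resolution and a right
`𝒳`-acyclic proper `𝒴`-coresolution. -/
def IsBalancedPair (𝒳 𝒴 : Set A) : Prop :=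
  (∀ M : A, ∃ (X : A) (f : X ⟶ M), IsRightApprox 𝒳 f) ∧
  (∀ M : A, ∃ (Y : A) (f : M ⟶ Y), IsLeftApprox 𝒴 f) ∧
  (∀ M : A, ∃ (P : CochainComplex A ℤ) (ε : P.X 0 ⟶ M),
    IsProperXResolution 𝒳 M P ε ∧ AugResLeftAcyclic 𝒴 M P ε) ∧
  (∀ N : A, ∃ (Q : CochainComplex A ℤ) (η : N ⟶ Q.X 0),
    IsProperYCoresolution 𝒴 N Q η ∧ AugCoresRightAcyclic 𝒳 N Q η)

/-- Vanishing of the relative Ext group `Ext⁎ⁱ(M, N)`: the `i`-th cohomology of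
`Hom(P, N)` vanishes for every proper `𝒳`-resolution `P` of `M`. -/
def ExtStarVanish (𝒳 : Set A) (i : ℕ) (M N : A) : Prop :=
  ∀ (P : CochainComplex A ℤ) (ε : P.X 0 ⟶ M), IsProperXResolution 𝒳 M P ε →
    ∀ h : P.X (-(i : ℤ)) ⟶ N, P.d (-(i : ℤ) - 1) (-(i : ℤ)) ≫ h = 0 →
      ∃ k : P.X (-(i : ℤ) + 1) ⟶ N, P.d (-(i : ℤ)) (-(i : ℤ) + 1) ≫ k = h

/-- A cotorsion pair relative to the balanced pair `(𝒳, 𝒴)`, defined by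
orthogonality with respect to `Ext⁎¹`. -/
def IsRelCotorsionPair (𝒳 𝒞 𝒟 : Set A) : Prop :=
  (∀ C : A, C ∈ 𝒞 ↔ ∀ D ∈ 𝒟, ExtStarVanish 𝒳 1 C D) ∧
  (∀ D : A, D ∈ 𝒟 ↔ ∀ C ∈ 𝒞, ExtStarVanish 𝒳 1 C D)

/-- `𝒳` is admissible: every right `𝒳`-approximation is an epimorphism. -/
def XAdmissible (𝒳 : Set A) : Prop :=
  ∀ (X M : A) (f : X ⟶ M), IsRightApprox 𝒳 f → Epi f

/-- `𝒴` is coadmissible: every left `𝒴`-approximation is a monomorphism. -/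
def YCoadmissible (𝒴 : Set A) : Prop :=
  ∀ (M Y : A) (f : M ⟶ Y), IsLeftApprox 𝒴 f → Mono f

/-- `𝒳`-resolution dimension of `M` is at most `n`. -/
def XResdimLE (𝒳 : Set A) (n : ℕ) (M : A) : Prop :=
  ∃ (P : CochainComplex A ℤ) (ε : P.X 0 ⟶ M),
    IsProperXResolution 𝒳 M P ε ∧ ∀ i : ℤ, i < -(n : ℤ) → IsZero (P.X i)

/-- `𝒴`-coresolution dimension of `N` is at most `n`. -/
def YCoresdimLE (𝒴 : Set A) (n : ℕ) (N : A) : Prop :=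
  ∃ (Q : CochainComplex A ℤ) (η : N ⟶ Q.X 0),
    IsProperYCoresolution 𝒴 N Q η ∧ ∀ i : ℤ, (n : ℤ) < i → IsZero (Q.X i)


open CochainComplex HomComplex

/-- One step of the descending construction of a null-homotopy: a `-1`-cochain whose coboundary
agrees with `φ` in degrees greater than `n` can be corrected in degree `n` so that its coboundary
also agrees with `φ` in degree `n`. -/
lemma RightAcyclicComplex.exists_cochain_correction {𝒳 : Set A} {P C : CochainComplex A ℤ}
    (hC : RightAcyclicComplex 𝒳 C) (φ : P ⟶ C) (n : ℤ) (hP : P.X n ∈ 𝒳)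
    (α : Cochain P C (-1))
    (hα : ∀ p, n < p → (δ (-1) 0 α).v p p (add_zero p) = φ.f p) :
    ∃ β : Cochain P C (-1),
      (∀ p, n ≤ p → (δ (-1) 0 β).v p p (add_zero p) = φ.f p) ∧
      ∀ p q hpq, p ≠ n → β.v p q hpq = α.v p q hpq := by
  let u := φ.f n - α.v n (n - 1) (by lia) ≫ C.d (n - 1) n -
    P.d n (n + 1) ≫ α.v (n + 1) n (by lia)
  have hu : u ≫ C.d n (n + 1) = 0 := by
    have eq := hα (n + 1) (by lia)
    simp only [δ_v (-1) 0 (neg_add_cancel 1) α (n + 1) (n + 1) (add_zero _) n (n + 2)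
      (by lia) (by lia), Int.negOnePow_zero, one_smul] at eq
    simp only [u, Preadditive.sub_comp, Category.assoc, C.d_comp_d, comp_zero, sub_zero,
      φ.comm, ← eq, Preadditive.comp_add, P.d_comp_d_assoc, zero_comp, add_zero, sub_self]
  obtain ⟨k, hk⟩ := hC _ hP n u hu
  refine ⟨α + Cochain.single k (-1), fun p hp => ?_, fun p q hpq hp => ?_⟩
  · obtain hp | rfl := hp.lt_or_eq
    · rw [δ_add, Cochain.add_v, hα p hp, add_eq_left,
        δ_v (-1) 0 (neg_add_cancel 1) _ p p _ (p - 1) (p + 1) rfl rfl,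
        Cochain.single_v_eq_zero _ _ _ _ _ (by lia),
        Cochain.single_v_eq_zero _ _ _ _ _ (by lia)]
      simp
    · rw [δ_v (-1) 0 (neg_add_cancel 1) _ n n _ (n - 1) (n + 1) rfl rfl, Cochain.add_v,
        Cochain.add_v, Cochain.single_v_eq_zero _ _ (n + 1) _ _ (by lia)]
      simp only [Cochain.single_v, Preadditive.add_comp, hk, u, Int.negOnePow_zero, one_smul,
        add_zero]
      abel
  · rw [Cochain.add_v, Cochain.single_v_eq_zero _ _ _ _ _ hp, add_zero]

/-- Every cochain map from a bounded-above complex with components in `𝒳` to a right `𝒳`-acyclic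
complex is null-homotopic. -/
lemma RightAcyclicComplex.nonempty_homotopy_zero {𝒳 : Set A} {P C : CochainComplex A ℤ}
    (hC : RightAcyclicComplex 𝒳 C) (hP : MinusComplexIn 𝒳 P) (φ : P ⟶ C) :
    Nonempty (Homotopy φ 0) := by
  obtain ⟨⟨b, hb⟩, hP⟩ := hP
  let S (n : ℕ) := { α : Cochain P C (-1) //
    ∀ p, b - n < p → (δ (-1) 0 α).v p p (add_zero p) = φ.f p }
  have step (n : ℕ) (x : S n) : ∃ y : S (n + 1),
      ∀ p q hpq, p ≠ b - n → y.1.v p q hpq = x.1.v p q hpq := by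
    obtain ⟨β, hβ, hβα⟩ := hC.exists_cochain_correction φ (b - n) (hP _) x.1 x.2
    exact ⟨⟨β, fun p hp => hβ p (by omega)⟩, hβα⟩
  choose next hnext using step
  let s (n : ℕ) : S n :=
    Nat.rec ⟨0, fun p hp => (hb p (by simpa using hp)).eq_of_src _ _⟩ next n
  have hs (m k : ℕ) (p q : ℤ) (hpq : p + (-1) = q) (hp : b - m < p) :
      (s (m + k)).1.v p q hpq = (s m).1.v p q hpq := by
    induction k with
    | zero => rfl
    | succ k ih => exact (hnext (m + k) (s (m + k)) p q hpq (by omega)).trans ih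
  let t : Cochain P C (-1) := Cochain.mk fun p q hpq => (s (b - p + 1).toNat).1.v p q hpq
  have ht (n : ℕ) (p q : ℤ) (hpq : p + (-1) = q) (hp : b - n < p) :
      t.v p q hpq = (s n).1.v p q hpq := by
    obtain ⟨k, rfl⟩ : ∃ k, n = (b - p + 1).toNat + k := Nat.exists_eq_add_of_le (by omega)
    exact (hs _ k p q hpq (by omega)).symm
  refine ⟨(Cochain.equivHomotopy φ 0).symm ⟨t, ?_⟩⟩
  rw [Cochain.ofHom_zero, add_zero]
  ext n
  have hn : b - ((b - n + 1).toNat : ℤ) < n := by omega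
  rw [Cochain.ofHom_v, ← (s (b - n + 1).toNat).2 n hn,
    δ_v (-1) 0 (neg_add_cancel 1) _ n n _ (n - 1) (n + 1) rfl rfl,
    δ_v (-1) 0 (neg_add_cancel 1) _ n n _ (n - 1) (n + 1) rfl rfl,
    ht (b - n + 1).toNat n (n - 1) (by omega) hn,
    ht (b - n + 1).toNat (n + 1) n (by omega) (by omega)]

/-- If the inclusion of the target of `f` into its mapping cone is null-homotopic, then `f` has a
right inverse up to homotopy. -/
lemma exists_homotopy_section_of_homotopy_inr {K L : CochainComplex A ℤ} (f : K ⟶ L)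
    (h : Homotopy (mappingCone.inr f) 0) :
    ∃ g : L ⟶ K, Nonempty (Homotopy (g ≫ f) (𝟙 L)) := by
  obtain ⟨γ, hγ⟩ := Cochain.equivHomotopy _ _ h
  rw [Cochain.ofHom_zero, add_zero] at hγ
  let α : Cochain L K 0 := γ.comp (mappingCone.fst f).1 (neg_add_cancel 1)
  let β : Cochain L L (-1) := γ.comp (mappingCone.snd f) (add_zero (-1))
  have hαβ : mappingCone.liftCochain f α β (neg_add_cancel 1) = γ := by
    rw [mappingCone.ext_cochain_to_iff f (-1) 0 (neg_add_cancel 1)]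
    simp [α, β]
  have key := mappingCone.δ_liftCochain f α β (neg_add_cancel 1) 1 (zero_add 1)
  rw [hαβ, ← hγ, mappingCone.ext_cochain_to_iff f 0 1 (zero_add 1)] at key
  obtain ⟨hfst, hsnd⟩ := key
  have hα : δ 0 1 α = 0 := by simpa using hfst
  have hβ : Cochain.ofHom (𝟙 L) = δ (-1) 0 β + α.comp (Cochain.ofHom f) (add_zero 0) := by
    simpa using hsnd
  refine ⟨Cocycle.homOf (Cocycle.mk α 1 (zero_add 1) hα),
    ⟨(Cochain.equivHomotopy _ _).symm ⟨-β, ?_⟩⟩⟩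
  rw [hβ, Cochain.ofHom_comp, Cocycle.cochain_ofHom_homOf_eq_coe, δ_neg, neg_add_cancel_left]
  rfl

theorem stmt3 (𝒳 : Set A) (X Aq : CochainComplex A ℤ) (hX : MinusComplexIn 𝒳 X)
    (f : Aq ⟶ X) (hf : RightQuasiIso 𝒳 f) :
    ∃ g : X ⟶ Aq, Nonempty (Homotopy (g ≫ f) (𝟙 X)) := by
  obtain ⟨h⟩ := RightAcyclicComplex.nonempty_homotopy_zero hf hX (mappingCone.inr f)
  exact exists_homotopy_section_of_homotopy_inr f h
end

section
/- Let (𝒳, 𝒴) be a balanced pair in an abelian category 𝒜 and (𝒞, 𝒟) a relative cotorsion pair. The following are equivalent: (1) 𝒞 is 𝒳-resolving (𝒳 ⊆ 𝒞 and 𝒞 is closed under ⁎-extensions and under kernels of ⁎-epimorphisms); (2) 𝒟 is 𝒴-coresolving; (3) Ext⁎ⁱ(C, D) = 0 for all i ≥ 1, C ∈ 𝒞, D ∈ 𝒟. -/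
open CategoryTheory Limits

universe v u

variable {A : Type u} [Category.{v} A] [Abelian A]

section stmt7

/-- closed under `⁎`-extensions -/
def ClosedUnderStarExt (𝒳 𝒴 ℰ : Set A) : Prop :=
  ∀ S : ShortComplex A, SESStarAcyclic 𝒳 𝒴 S → S.X₁ ∈ ℰ → S.X₃ ∈ ℰ → S.X₂ ∈ ℰ

/-- closed under `⁎`-epimorphisms -/
def ClosedUnderStarEpi (𝒳 𝒴 ℰ : Set A) : Prop :=
  ∀ S : ShortComplex A, SESStarAcyclic 𝒳 𝒴 S → S.X₂ ∈ ℰ → S.X₃ ∈ ℰ → S.X₁ ∈ ℰ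

/-- closed under `⁎`-monomorphisms -/
def ClosedUnderStarMono (𝒳 𝒴 ℰ : Set A) : Prop :=
  ∀ S : ShortComplex A, SESStarAcyclic 𝒳 𝒴 S → S.X₁ ∈ ℰ → S.X₂ ∈ ℰ → S.X₃ ∈ ℰ

/-- `ℰ` is `𝒳`-resolving -/
def XResolving (𝒳 𝒴 ℰ : Set A) : Prop :=
  𝒳 ⊆ ℰ ∧ ClosedUnderStarExt 𝒳 𝒴 ℰ ∧ ClosedUnderStarEpi 𝒳 𝒴 ℰ

/-- `ℰ` is `𝒴`-coresolving -/
def YCoresolving (𝒳 𝒴 ℰ : Set A) : Prop :=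
  𝒴 ⊆ ℰ ∧ ClosedUnderStarExt 𝒳 𝒴 ℰ ∧ ClosedUnderStarMono 𝒳 𝒴 ℰ

section Helpers

variable {𝒳 𝒴 : Set A}

/-- `Hom(-, N)` carries `X ⟶ Y ⟶ Z` to a sequence that is exact in the middle. -/
def HomExactAt {X Y Z : A} (f : X ⟶ Y) (g : Y ⟶ Z) (N : A) : Prop :=
  ∀ h : Y ⟶ N, f ≫ h = 0 → ∃ k : Z ⟶ N, g ≫ k = h

/-- The first three terms `W ⟶ V ⟶ U ⟶ C` of a proper `𝒳`-resolution of `C`. -/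
structure IsProperPresentation (𝒳 : Set A) {W V U C : A}
    (w : W ⟶ V) (v : V ⟶ U) (e : U ⟶ C) : Prop where
  mem_W : W ∈ 𝒳
  mem_V : V ∈ 𝒳
  mem_U : U ∈ 𝒳
  w_v : w ≫ v = 0
  v_e : v ≫ e = 0
  lift_e : ∀ X ∈ 𝒳, ∀ h : X ⟶ C, ∃ k : X ⟶ U, k ≫ e = h
  lift_v : ∀ X ∈ 𝒳, ∀ h : X ⟶ U, h ≫ e = 0 → ∃ k : X ⟶ V, k ≫ v = h
  lift_w : ∀ X ∈ 𝒳, ∀ h : X ⟶ V, h ≫ v = 0 → ∃ k : X ⟶ W, k ≫ w = h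

theorem extStarVanish_iff {i : ℕ} {M N : A} :
    ExtStarVanish 𝒳 i M N ↔ ∀ (P : CochainComplex A ℤ) (ε : P.X 0 ⟶ M),
      IsProperXResolution 𝒳 M P ε → ∀ a b c : ℤ, a + 1 = b → b + 1 = c → b = -(i : ℤ) →
        HomExactAt (P.d a b) (P.d b c) N := by
  constructor
  · intro H P ε hP a b c hab hbc hb
    obtain rfl : a = -(i : ℤ) - 1 := by omega
    subst hb hbc
    exact H P ε hP
  · intro H P ε hP
    exact H P ε hP _ _ _ (by omega) rfl rfl

theorem IsProperXResolution.lift {M : A} {P : CochainComplex A ℤ} {ε : P.X 0 ⟶ M}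
    (hP : IsProperXResolution 𝒳 M P ε) {a b c : ℤ} (hab : a + 1 = b) (hbc : b + 1 = c)
    (hb : b < 0) {X : A} (hX : X ∈ 𝒳) (h : X ⟶ P.X b) (hh : h ≫ P.d b c = 0) :
    ∃ k : X ⟶ P.X a, k ≫ P.d a b = h := by
  obtain rfl : a = b - 1 := by omega
  subst hbc
  exact (hP.2.2.2 X hX).2.2 b hb h hh

theorem IsProperXResolution.presentation {M : A} {P : CochainComplex A ℤ} {ε : P.X 0 ⟶ M}
    (hP : IsProperXResolution 𝒳 M P ε) :
    IsProperPresentation 𝒳 (P.d (-2) (-1)) (P.d (-1) 0) ε where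
  mem_W := hP.2.1 _ (by omega)
  mem_V := hP.2.1 _ (by omega)
  mem_U := hP.2.1 _ (by omega)
  w_v := P.d_comp_d _ _ _
  v_e := hP.2.2.1
  lift_e X hX := (hP.2.2.2 X hX).1
  lift_v X hX := (hP.2.2.2 X hX).2.1
  lift_w _ hX h hh := hP.lift (by omega) (by omega) (by omega) hX h hh

theorem AugCoresRightAcyclic.lift {N : A} {Q : CochainComplex A ℤ} {η : N ⟶ Q.X 0}
    (hQ : AugCoresRightAcyclic 𝒳 N Q η) {a b c : ℤ} (hab : a + 1 = b) (hbc : b + 1 = c)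
    (hb : 0 < b) {X : A} (hX : X ∈ 𝒳) (h : X ⟶ Q.X b) (hh : h ≫ Q.d b c = 0) :
    ∃ k : X ⟶ Q.X a, k ≫ Q.d a b = h := by
  obtain rfl : a = b - 1 := by omega
  subst hbc
  exact (hQ X hX).2.2 b hb h hh

theorem AugCoresRightAcyclic.cancel {N : A} {Q : CochainComplex A ℤ} {η : N ⟶ Q.X 0}
    (hQ : AugCoresRightAcyclic 𝒳 N Q η) {X : A} (hX : X ∈ 𝒳) {f g : X ⟶ N}
    (h : f ≫ η = g ≫ η) : f = g :=
  sub_eq_zero.1 ((hQ X hX).1 _ (by rw [Preadditive.sub_comp, h, sub_self]))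

namespace IsRightApprox

theorem eq_zero_of_comp (hbp : IsBalancedPair 𝒳 𝒴) {X M Y : A} {f : X ⟶ M}
    (hf : IsRightApprox 𝒳 f) (hY : Y ∈ 𝒴) (h : M ⟶ Y) (hh : f ≫ h = 0) : h = 0 := by
  obtain ⟨P, ε, hP, hPY⟩ := hbp.2.2.1 M
  obtain ⟨k, hk⟩ := hf.2 _ (hP.2.1 0 le_rfl) ε
  exact (hPY Y hY).1 h (by rw [← hk, Category.assoc, hh, comp_zero])

theorem cancel (hbp : IsBalancedPair 𝒳 𝒴) {X M Y : A} {f : X ⟶ M}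
    (hf : IsRightApprox 𝒳 f) (hY : Y ∈ 𝒴) {h k : M ⟶ Y} (hh : f ≫ h = f ≫ k) : h = k :=
  sub_eq_zero.1 (hf.eq_zero_of_comp hbp hY _ (by rw [Preadditive.comp_sub, hh, sub_self]))

theorem exists_desc (hbp : IsBalancedPair 𝒳 𝒴) {X M Y : A} {f : X ⟶ M}
    (hf : IsRightApprox 𝒳 f) (hY : Y ∈ 𝒴) (h : X ⟶ Y) (hh : kernel.ι f ≫ h = 0) :
    ∃ k : M ⟶ Y, f ≫ k = h := by
  obtain ⟨P, ε, hP, hPY⟩ := hbp.2.2.1 M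
  obtain ⟨β, hβ⟩ := hf.2 _ (hP.2.1 0 le_rfl) ε
  obtain ⟨α, hα⟩ := (hP.2.2.2 X hf.1).1 f
  have vanish : ∀ {T : A} (t : T ⟶ X), t ≫ f = 0 → t ≫ h = 0 := fun t ht => by
    rw [← kernel.lift_ι f t ht, Category.assoc, hh, comp_zero]
  obtain ⟨k, hk⟩ := (hPY Y hY).2.1 (β ≫ h) (by
    rw [← Category.assoc]
    exact vanish _ (by rw [Category.assoc, hβ, hP.2.2.1]))
  refine ⟨k, ?_⟩
  have := vanish (α ≫ β - 𝟙 X) (by simp [hβ, hα])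
  rw [← hα, Category.assoc, hk, ← sub_eq_zero, ← this]
  simp

theorem exists_extension (hbp : IsBalancedPair 𝒳 𝒴) {X M Y : A} {f : X ⟶ M}
    (hf : IsRightApprox 𝒳 f) (hY : Y ∈ 𝒴) (h : kernel f ⟶ Y) :
    ∃ k : X ⟶ Y, kernel.ι f ≫ k = h := by
  obtain ⟨P, ε, hP, hPY⟩ := hbp.2.2.1 M
  obtain ⟨β, hβ⟩ := hf.2 _ (hP.2.1 0 le_rfl) ε
  obtain ⟨α, hα⟩ := (hP.2.2.2 X hf.1).1 f
  have hpres := hP.presentation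
  let p := kernel.lift ε (P.d (-1) 0) hP.2.2.1
  have hp : IsRightApprox 𝒳 p := ⟨hpres.mem_V, fun T hT t => by
    obtain ⟨s, hs⟩ := hpres.lift_v T hT (t ≫ kernel.ι ε) (by simp)
    exact ⟨s, by simp [← cancel_mono (kernel.ι ε), p, hs]⟩⟩
  let βK : kernel ε ⟶ kernel f := kernel.lift f (kernel.ι ε ≫ β) (by simp [hβ])
  let αK : kernel f ⟶ kernel ε := kernel.lift ε (kernel.ι f ≫ α) (by simp [hα])
  obtain ⟨u, hu⟩ := (hPY Y hY).2.2 (-1) (by omega) (p ≫ βK ≫ h) (by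
    have : P.d (-1 - 1) (-1) ≫ p = 0 := by simp [← cancel_mono (kernel.ι ε), p]
    rw [← Category.assoc, this, zero_comp])
  have hu' : kernel.ι ε ≫ u = βK ≫ h := hp.cancel hbp hY (by
    rw [← hu, ← Category.assoc, kernel.lift_ι]
    rfl)
  let γ : X ⟶ kernel f := kernel.lift f (𝟙 X - α ≫ β) (by simp [hβ, hα])
  have hγ : kernel.ι f ≫ γ = 𝟙 _ - αK ≫ βK := by
    simp [← cancel_mono (kernel.ι f), γ, αK, βK]
  refine ⟨α ≫ u + γ ≫ h, ?_⟩
  have h₁ : kernel.ι f ≫ α ≫ u = αK ≫ βK ≫ h := by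
    rw [← hu', ← Category.assoc, ← Category.assoc, kernel.lift_ι]
  rw [Preadditive.comp_add, h₁, ← Category.assoc _ γ, hγ]
  simp

/-- The kernel-image sequence of a right `𝒳`-approximation is `⁎`-acyclic. -/
theorem starAcyclic (hbp : IsBalancedPair 𝒳 𝒴) {X M : A} {f : X ⟶ M}
    (hf : IsRightApprox 𝒳 f) :
    SESStarAcyclic 𝒳 𝒴 (ShortComplex.mk (kernel.ι f) (factorThruImage f)
      (by simp [← cancel_mono (image.ι f)])) := by
  have hexact : ∀ {T : A} (t : T ⟶ X), t ≫ factorThruImage f = 0 →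
      ∃ k : T ⟶ kernel f, k ≫ kernel.ι f = t := fun t ht =>
    ⟨kernel.lift f t (by rw [← image.fac f, ← Category.assoc, ht, zero_comp]), by simp⟩
  have hse : (ShortComplex.mk (kernel.ι f) (factorThruImage f)
      (by simp [← cancel_mono (image.ι f)])).ShortExact :=
    { exact := ShortComplex.exact_of_f_is_kernel _
        (KernelFork.IsLimit.ofι' _ _ fun t ht =>
          ⟨(hexact t ht).choose, (hexact t ht).choose_spec⟩)
      mono_f := inferInstanceAs (Mono (kernel.ι f))
      epi_g := inferInstanceAs (Epi (factorThruImage f)) }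
  refine ⟨hse, fun T hT => ⟨fun a b hab => (cancel_mono (kernel.ι f)).1 hab,
    fun t ht => hexact t ht, fun t => ?_⟩, fun Y hY => ⟨fun a b hab =>
    (cancel_epi (factorThruImage f)).1 hab, fun t ht => ?_, fun t =>
    hf.exists_extension hbp hY t⟩⟩
  · obtain ⟨s, hs⟩ := hf.2 T hT (t ≫ image.ι f)
    exact ⟨s, by simp [← cancel_mono (image.ι f), hs]⟩
  · obtain ⟨k, hk⟩ := hf.exists_desc hbp hY t ht
    exact ⟨image.ι f ≫ k, by simp [hk]⟩

end IsRightApprox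

namespace IsProperPresentation

variable {W V U C : A} {w : W ⟶ V} {v : V ⟶ U} {e : U ⟶ C}

theorem isRightApprox (hp : IsProperPresentation 𝒳 w v e) : IsRightApprox 𝒳 e :=
  ⟨hp.mem_U, hp.lift_e⟩

theorem isRightApprox_kernelLift (hp : IsProperPresentation 𝒳 w v e) :
    IsRightApprox 𝒳 (kernel.lift e v hp.v_e) :=
  ⟨hp.mem_V, fun T hT t => by
    obtain ⟨s, hs⟩ := hp.lift_v T hT (t ≫ kernel.ι e) (by simp)
    exact ⟨s, by simp [← cancel_mono (kernel.ι e), hs]⟩⟩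

theorem homExactAt_U (hbp : IsBalancedPair 𝒳 𝒴) (hp : IsProperPresentation 𝒳 w v e)
    {Y : A} (hY : Y ∈ 𝒴) : HomExactAt v e Y := fun h hh =>
  hp.isRightApprox.exists_desc hbp hY h
    (hp.isRightApprox_kernelLift.eq_zero_of_comp hbp hY _ (by simpa using hh))

theorem homExactAt_V (hbp : IsBalancedPair 𝒳 𝒴) (hp : IsProperPresentation 𝒳 w v e)
    {Y : A} (hY : Y ∈ 𝒴) : HomExactAt w v Y := by
  intro h hh
  let f := kernel.lift e v hp.v_e
  have hfv : f ≫ kernel.ι e = v := kernel.lift_ι _ _ _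
  have hwf : w ≫ f = 0 := by simp [← cancel_mono (kernel.ι e), f, hp.w_v]
  have hw : IsRightApprox 𝒳 (kernel.lift f w hwf) := ⟨hp.mem_W, fun T hT t => by
    obtain ⟨s, hs⟩ := hp.lift_w T hT (t ≫ kernel.ι f) (by simp [← hfv])
    exact ⟨s, by simp [← cancel_mono (kernel.ι f), hs]⟩⟩
  obtain ⟨k, hk⟩ := hp.isRightApprox_kernelLift.exists_desc hbp hY h
    (hw.eq_zero_of_comp hbp hY _ (by rwa [← Category.assoc, kernel.lift_ι]))
  obtain ⟨l, hl⟩ := hp.isRightApprox.exists_extension hbp hY k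
  exact ⟨l, by rw [← hfv, Category.assoc, hl, hk]⟩

/-- A presentation of the image of a right `𝒳`-approximation of `M` is a presentation of `M`. -/
theorem comp_image {X M : A} {f : X ⟶ M} (hf : IsRightApprox 𝒳 f)
    {e : U ⟶ image f} (hp : IsProperPresentation 𝒳 w v e) :
    IsProperPresentation 𝒳 w v (e ≫ image.ι f) where
  mem_W := hp.mem_W
  mem_V := hp.mem_V
  mem_U := hp.mem_U
  w_v := hp.w_v
  v_e := by rw [← Category.assoc, hp.v_e, zero_comp]
  lift_e T hT t := by
    obtain ⟨s, hs⟩ := hf.2 T hT t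
    obtain ⟨r, hr⟩ := hp.lift_e T hT (s ≫ factorThruImage f)
    exact ⟨r, by rw [← Category.assoc, hr, Category.assoc, image.fac, hs]⟩
  lift_v T hT t ht := hp.lift_v T hT t (by
    rw [← cancel_mono (image.ι f), Category.assoc, ht, zero_comp])
  lift_w := hp.lift_w

variable {N : A} {Q : CochainComplex A ℤ} {η : N ⟶ Q.X 0}

/-- Balance in degree one: from the resolution to the coresolution. -/
theorem homCoresolution_exact (hbp : IsBalancedPair 𝒳 𝒴) (hp : IsProperPresentation 𝒳 w v e)
    (hQ : IsProperYCoresolution 𝒴 N Q η) (hQX : AugCoresRightAcyclic 𝒳 N Q η)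
    (H : HomExactAt w v N) (g : C ⟶ Q.X 1) (hg : g ≫ Q.d 1 2 = 0) :
    ∃ k : C ⟶ Q.X 0, k ≫ Q.d 0 1 = g := by
  have hQ₀ := hQ.2.1 0 le_rfl
  have hQ₁ := hQ.2.1 1 (by omega)
  obtain ⟨a, ha⟩ := hQX.lift (a := 0) (c := 2) (by omega) (by omega) (by omega) hp.mem_U
    (e ≫ g) (by rw [Category.assoc, hg, comp_zero])
  obtain ⟨b, hb⟩ := (hQX V hp.mem_V).2.1 (v ≫ a)
    (by rw [Category.assoc, ha, ← Category.assoc, hp.v_e, zero_comp])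
  obtain ⟨c, hc⟩ := H b (hQX.cancel hp.mem_W
    (by rw [Category.assoc, hb, ← Category.assoc, hp.w_v, zero_comp, zero_comp]))
  obtain ⟨k, hk⟩ := hp.homExactAt_U hbp hQ₀ (a - c ≫ η)
    (by rw [Preadditive.comp_sub, ← Category.assoc _ c, hc, hb, sub_self])
  refine ⟨k, hp.isRightApprox.cancel hbp hQ₁ ?_⟩
  rw [← Category.assoc, hk, Preadditive.sub_comp, ha, Category.assoc, hQ.2.2.1, comp_zero,
    sub_zero]

/-- Balance in degree one: from the coresolution to the resolution. -/
theorem homExactAt_of_homCoresolution_exact (hbp : IsBalancedPair 𝒳 𝒴)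
    (hp : IsProperPresentation 𝒳 w v e)
    (hQ : IsProperYCoresolution 𝒴 N Q η) (hQX : AugCoresRightAcyclic 𝒳 N Q η)
    (H : ∀ g : C ⟶ Q.X 1, g ≫ Q.d 1 2 = 0 → ∃ k : C ⟶ Q.X 0, k ≫ Q.d 0 1 = g) :
    HomExactAt w v N := by
  intro h hh
  have hQ₀ := hQ.2.1 0 le_rfl
  have hQ₁ := hQ.2.1 1 (by omega)
  have hQ₂ := hQ.2.1 2 (by omega)
  obtain ⟨a, ha⟩ := hp.homExactAt_V hbp hQ₀ (h ≫ η)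
    (by rw [← Category.assoc, hh, zero_comp])
  obtain ⟨b, hb⟩ := hp.homExactAt_U hbp hQ₁ (a ≫ Q.d 0 1)
    (by rw [← Category.assoc, ha, Category.assoc, hQ.2.2.1, comp_zero])
  obtain ⟨c, hc⟩ := H b (hp.isRightApprox.eq_zero_of_comp hbp hQ₂ _
    (by rw [← Category.assoc, hb, Category.assoc, Q.d_comp_d, comp_zero]))
  obtain ⟨k, hk⟩ := (hQX U hp.mem_U).2.1 (a - e ≫ c)
    (by rw [Preadditive.sub_comp, Category.assoc, hc, hb, sub_self])
  refine ⟨k, hQX.cancel hp.mem_V ?_⟩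
  rw [Category.assoc, hk, Preadditive.comp_sub, ← Category.assoc v e, hp.v_e, zero_comp,
    sub_zero, ha]

end IsProperPresentation

/-- Vanishing of `Ext⁎¹` may be tested on any presentation. -/
theorem ExtStarVanish.homExactAt (hbp : IsBalancedPair 𝒳 𝒴) {C N : A}
    (H : ExtStarVanish 𝒳 1 C N) {W V U : A} {w : W ⟶ V} {v : V ⟶ U} {e : U ⟶ C}
    (hp : IsProperPresentation 𝒳 w v e) : HomExactAt w v N := by
  obtain ⟨Q, η, hQ, hQX⟩ := hbp.2.2.2 N
  obtain ⟨P, ε, hP, -⟩ := hbp.2.2.1 C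
  exact hp.homExactAt_of_homCoresolution_exact hbp hQ hQX
    (hP.presentation.homCoresolution_exact hbp hQ hQX
      (extStarVanish_iff.1 H P ε hP _ _ _ (by omega) (by omega) (by simp)))

theorem extStarVanish_one_of_presentation {C N : A}
    (H : ∀ {W V U : A} {w : W ⟶ V} {v : V ⟶ U} {e : U ⟶ C},
      IsProperPresentation 𝒳 w v e → HomExactAt w v N) : ExtStarVanish 𝒳 1 C N :=
  fun _ _ hP => H hP.presentation

theorem extStarVanish_one_of_mem {C : A} (hC : C ∈ 𝒳) (N : A) : ExtStarVanish 𝒳 1 C N := by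
  refine extStarVanish_one_of_presentation fun {W V U w v e} hp h hh => ?_
  obtain ⟨s, hs⟩ := hp.lift_e C hC (𝟙 C)
  obtain ⟨γ, hγ⟩ := hp.lift_v U hp.mem_U (𝟙 U - e ≫ s) (by simp [hs])
  obtain ⟨δ, hδ⟩ := hp.lift_w V hp.mem_V (v ≫ γ - 𝟙 V) (by
    simp [hγ, reassoc_of% hp.v_e])
  refine ⟨γ ≫ h, ?_⟩
  rw [← sub_eq_zero]
  calc v ≫ γ ≫ h - h = (v ≫ γ - 𝟙 V) ≫ h := by simp
    _ = 0 := by rw [← hδ, Category.assoc, hh, comp_zero]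

/-- Every short piece of a proper `𝒳`-resolution of `M ∈ 𝒞` is a presentation of an object of
`𝒞`, if `𝒞` is stable under kernels of right `𝒳`-approximations. -/
theorem IsProperXResolution.exists_presentation {𝒞 : Set A}
    (h𝒞 : ∀ {X M : A} (f : X ⟶ M), IsRightApprox 𝒳 f → M ∈ 𝒞 → kernel f ∈ 𝒞)
    {M : A} (hM : M ∈ 𝒞) {P : CochainComplex A ℤ} {ε : P.X 0 ⟶ M}
    (hP : IsProperXResolution 𝒳 M P ε) {a b c : ℤ} (hab : a + 1 = b) (hbc : b + 1 = c)
    (hb : b < 0) :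
    ∃ (K : A) (e : P.X c ⟶ K), K ∈ 𝒞 ∧ IsProperPresentation 𝒳 (P.d a b) (P.d b c) e := by
  suffices H : ∀ c : ℤ, c ≤ 0 → ∀ a b : ℤ, a + 1 = b → b + 1 = c → ∃ (K : A) (e : P.X c ⟶ K),
      K ∈ 𝒞 ∧ IsProperPresentation 𝒳 (P.d a b) (P.d b c) e from H c (by omega) a b hab hbc
  intro c hc
  induction c, hc using Int.leInductionDown with
  | base =>
    intro a b hab hbc
    obtain rfl : b = -1 := by omega
    obtain rfl : a = -2 := by omega
    exact ⟨M, ε, hM, hP.presentation⟩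
  | pred c hc ih =>
    intro a b hab hbc
    obtain ⟨K, e, hK, hp⟩ := ih b (c - 1) hbc (by omega)
    refine ⟨kernel e, kernel.lift e (P.d (c - 1) c) hp.v_e, h𝒞 e hp.isRightApprox hK, ?_⟩
    exact
      { mem_W := hP.2.1 _ (by omega)
        mem_V := hp.mem_W
        mem_U := hp.mem_V
        w_v := P.d_comp_d _ _ _
        v_e := by simp [← cancel_mono (kernel.ι e)]
        lift_e := hp.isRightApprox_kernelLift.2
        lift_v := fun X hX h hh => hp.lift_w X hX h (by
          rw [← kernel.lift_ι e _ hp.v_e, ← Category.assoc, hh, zero_comp])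
        lift_w := fun X hX h hh => hP.lift hab hbc (by omega) hX h hh }

theorem IsProperXResolution.homExactAt (hbp : IsBalancedPair 𝒳 𝒴)
    {M : A} {P : CochainComplex A ℤ} {ε : P.X 0 ⟶ M}
    (hP : IsProperXResolution 𝒳 M P ε) {a b c : ℤ} (hab : a + 1 = b) (hbc : b + 1 = c)
    (hb : b < 0) {Y : A} (hY : Y ∈ 𝒴) : HomExactAt (P.d a b) (P.d b c) Y := by
  obtain ⟨_, _, -, hp⟩ := hP.exists_presentation (𝒞 := Set.univ)
    (fun _ _ _ => Set.mem_univ _) (Set.mem_univ M) hab hbc hb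
  exact hp.homExactAt_V hbp hY

theorem extStarVanish_of_mem_right (hbp : IsBalancedPair 𝒳 𝒴) {i : ℕ} (hi : 1 ≤ i) (M : A)
    {Y : A} (hY : Y ∈ 𝒴) : ExtStarVanish 𝒳 i M Y :=
  extStarVanish_iff.2 fun _ _ hP _ _ _ hab hbc hb => hP.homExactAt hbp hab hbc (by omega) hY

/-- Balance in degree two: from the resolution to the coresolution. -/
theorem ExtStarVanish.homCoresolution_exact_two (hbp : IsBalancedPair 𝒳 𝒴) {C N : A}
    (H : ExtStarVanish 𝒳 2 C N) {Q : CochainComplex A ℤ} {η : N ⟶ Q.X 0}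
    (hQ : IsProperYCoresolution 𝒴 N Q η) (hQX : AugCoresRightAcyclic 𝒳 N Q η)
    (g : C ⟶ Q.X 2) (hg : g ≫ Q.d 2 3 = 0) :
    ∃ k : C ⟶ Q.X 1, k ≫ Q.d 1 2 = g := by
  obtain ⟨P, ε, hP, -⟩ := hbp.2.2.1 C
  have hp := hP.presentation
  have hX₃ : P.X (-3) ∈ 𝒳 := hP.2.1 _ (by omega)
  obtain ⟨a, ha⟩ := hQX.lift (a := 1) (c := 3) (by omega) (by omega) (by omega) hp.mem_U
    (ε ≫ g) (by rw [Category.assoc, hg, comp_zero])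
  obtain ⟨b, hb⟩ := hQX.lift (a := 0) (c := 2) (by omega) (by omega) (by omega) hp.mem_V
    (P.d (-1) 0 ≫ a) (by rw [Category.assoc, ha, ← Category.assoc, hp.v_e, zero_comp])
  obtain ⟨c, hc⟩ := (hQX _ hp.mem_W).2.1 (P.d (-2) (-1) ≫ b)
    (by rw [Category.assoc, hb, ← Category.assoc, hp.w_v, zero_comp])
  obtain ⟨f, hf⟩ := extStarVanish_iff.1 H P ε hP (-3) (-2) (-1) (by omega) (by omega) (by simp) c
    (hQX.cancel hX₃ (by
      rw [Category.assoc, hc, ← Category.assoc, P.d_comp_d, zero_comp, zero_comp]))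
  obtain ⟨l, hl⟩ := hp.homExactAt_V hbp (hQ.2.1 0 le_rfl) (b - f ≫ η)
    (by rw [Preadditive.comp_sub, ← Category.assoc _ f, hf, hc, sub_self])
  obtain ⟨k, hk⟩ := hp.homExactAt_U hbp (hQ.2.1 1 (by omega)) (a - l ≫ Q.d 0 1) (by
    rw [Preadditive.comp_sub, ← Category.assoc _ l, hl, Preadditive.sub_comp, hb,
      Category.assoc f, hQ.2.2.1, comp_zero, sub_zero, sub_self])
  refine ⟨k, hp.isRightApprox.cancel hbp (hQ.2.1 2 (by omega)) ?_⟩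
  rw [← Category.assoc, hk, Preadditive.sub_comp, ha, Category.assoc, Q.d_comp_d, comp_zero,
    sub_zero]

/-- The image-cokernel sequence of the start of a coresolution is `⁎`-acyclic. -/
theorem IsProperYCoresolution.starAcyclic (hbp : IsBalancedPair 𝒳 𝒴) {N : A}
    {Q : CochainComplex A ℤ} {η : N ⟶ Q.X 0} (hQ : IsProperYCoresolution 𝒴 N Q η)
    (hQX : AugCoresRightAcyclic 𝒳 N Q η) :
    SESStarAcyclic 𝒳 𝒴 (ShortComplex.mk (image.ι η) (cokernel.π η)
      (by simp [← cancel_epi (factorThruImage η)])) := by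
  have hexact : ∀ {T : A} (t : Q.X 0 ⟶ T), image.ι η ≫ t = 0 →
      ∃ k : cokernel η ⟶ T, cokernel.π η ≫ k = t := fun t ht =>
    ⟨cokernel.desc η t (by rw [← image.fac η, Category.assoc, ht, comp_zero]), by simp⟩
  let q := cokernel.desc η (Q.d 0 1) hQ.2.2.1
  have hq : cokernel.π η ≫ q = Q.d 0 1 := cokernel.π_desc _ _ _
  have hse : (ShortComplex.mk (image.ι η) (cokernel.π η)
      (by simp [← cancel_epi (factorThruImage η)])).ShortExact :=
    { exact := ShortComplex.exact_of_g_is_cokernel _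
        (CokernelCofork.IsColimit.ofπ' _ _ fun t ht =>
          ⟨(hexact t ht).choose, (hexact t ht).choose_spec⟩)
      mono_f := inferInstanceAs (Mono (image.ι η))
      epi_g := inferInstanceAs (Epi (cokernel.π η)) }
  have hqX : ∀ X ∈ 𝒳, ∀ x : X ⟶ cokernel η, x ≫ q = 0 → x = 0 := by
    intro X hX x hx
    obtain ⟨Q', η', hQ', hQX'⟩ := hbp.2.2.2 (cokernel η)
    have hQ₀' := hQ'.2.1 0 le_rfl
    obtain ⟨k, hk⟩ := ((hQ.2.2.2 _ hQ₀').2.1 (cokernel.π η ≫ η') (by simp))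
    have hqk : q ≫ k = η' := by
      rw [← cancel_epi (cokernel.π η), ← Category.assoc, hq, hk]
    exact (hQX' X hX).1 x (by rw [← hqk, ← Category.assoc, hx, zero_comp])
  refine ⟨hse, fun X hX => ⟨fun a b hab => (cancel_mono (image.ι η)).1 hab, fun t ht => ?_,
    fun t => ?_⟩, fun Y hY => ⟨fun a b hab => (cancel_epi (cokernel.π η)).1 hab,
    fun t ht => hexact t ht, fun t => ?_⟩⟩
  · obtain ⟨k, hk⟩ := (hQX X hX).2.1 t (by
      rw [← hq, ← Category.assoc]
      exact (congrArg (· ≫ q) ht).trans zero_comp)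
    exact ⟨k ≫ factorThruImage η, by simp [hk]⟩
  · obtain ⟨k, hk⟩ := hQX.lift (a := 0) (c := 2) (by omega) (by omega) (by omega) hX (t ≫ q) (by
      have : q ≫ Q.d 1 2 = 0 := by
        rw [← cancel_epi (cokernel.π η), ← Category.assoc, hq, Q.d_comp_d, comp_zero]
      rw [Category.assoc, this, comp_zero])
    refine ⟨k, sub_eq_zero.1 (hqX X hX (k ≫ cokernel.π η - t) ?_)⟩
    rw [Preadditive.sub_comp, Category.assoc, hq, hk, sub_self]
  · obtain ⟨k, hk⟩ := (hQ.2.2.2 Y hY).1 (factorThruImage η ≫ t)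
    exact ⟨k, by simp [← cancel_epi (factorThruImage η), hk]⟩

/-- Replacing `N` by the image of `N ⟶ Q⁰` does not affect vanishing of `Ext⁎¹`. -/
theorem ExtStarVanish.image_right (hbp : IsBalancedPair 𝒳 𝒴) {C N : A}
    (H : ExtStarVanish 𝒳 1 C N) {Q : CochainComplex A ℤ} {η : N ⟶ Q.X 0}
    (hQ : IsProperYCoresolution 𝒴 N Q η) (hQX : AugCoresRightAcyclic 𝒳 N Q η) :
    ExtStarVanish 𝒳 1 C (image η) := by
  refine extStarVanish_one_of_presentation fun {W V U w v e} hp h hh => ?_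
  obtain ⟨h', hh'⟩ := (hQX V hp.mem_V).2.1 (h ≫ image.ι η) (by
    have : image.ι η ≫ Q.d 0 1 = 0 := by
      simp [← cancel_epi (factorThruImage η), hQ.2.2.1]
    rw [Category.assoc, this, comp_zero])
  obtain ⟨k, hk⟩ := H.homExactAt hbp hp h' (hQX.cancel hp.mem_W (by
    rw [Category.assoc, hh', ← Category.assoc, hh, zero_comp, zero_comp]))
  refine ⟨k ≫ factorThruImage η, ?_⟩
  rw [← cancel_mono (image.ι η), Category.assoc, Category.assoc, image.fac, ← Category.assoc,
    hk, hh']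

/-- The segment `Ext⁎ⁱ(C, S.X₁) ⟶ Ext⁎ⁱ(C, S.X₂) ⟶ Ext⁎ⁱ(C, S.X₃)` of the long exact sequence. -/
theorem ExtStarVanish.extension_right {S : ShortComplex A} (hS : SESRightAcyclic 𝒳 S) {i : ℕ}
    (hi : 1 ≤ i) {C : A} (h₁ : ExtStarVanish 𝒳 i C S.X₁) (h₃ : ExtStarVanish 𝒳 i C S.X₃) :
    ExtStarVanish 𝒳 i C S.X₂ := by
  refine extStarVanish_iff.2 fun P ε hP a b c hab hbc hb h hh => ?_
  have hXa : P.X a ∈ 𝒳 := hP.2.1 _ (by omega)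
  have hXb : P.X b ∈ 𝒳 := hP.2.1 _ (by omega)
  have hXc : P.X c ∈ 𝒳 := hP.2.1 _ (by omega)
  obtain ⟨l, hl⟩ := extStarVanish_iff.1 h₃ P ε hP a b c hab hbc hb (h ≫ S.g)
    (by rw [← Category.assoc, hh, zero_comp])
  obtain ⟨m, rfl⟩ := (hS _ hXc).2.2 l
  obtain ⟨n, hn⟩ := (hS _ hXb).2.1 (h - P.d b c ≫ m) (by
    rw [Preadditive.sub_comp, Category.assoc, hl, sub_self])
  obtain ⟨r, hr⟩ := extStarVanish_iff.1 h₁ P ε hP a b c hab hbc hb n ((hS _ hXa).1 (by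
    simp [hn, hh]))
  refine ⟨r ≫ S.f + m, ?_⟩
  rw [Preadditive.comp_add, ← Category.assoc, hr, hn, sub_add_cancel]

/-- The segment `Ext⁎ⁱ(C, S.X₂) ⟶ Ext⁎ⁱ(C, S.X₃) ⟶ Ext⁎ⁱ⁺¹(C, S.X₁)` of the long exact
sequence. -/
theorem ExtStarVanish.cokernel_right {S : ShortComplex A} (hS : SESRightAcyclic 𝒳 S) {i : ℕ}
    (hi : 1 ≤ i) {C : A} (h₂ : ExtStarVanish 𝒳 i C S.X₂) (h₁ : ExtStarVanish 𝒳 (i + 1) C S.X₁) :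
    ExtStarVanish 𝒳 i C S.X₃ := by
  refine extStarVanish_iff.2 fun P ε hP a b c hab hbc hb h hh => ?_
  have hXz : P.X (a - 1) ∈ 𝒳 := hP.2.1 _ (by omega)
  have hXa : P.X a ∈ 𝒳 := hP.2.1 _ (by omega)
  have hXb : P.X b ∈ 𝒳 := hP.2.1 _ (by omega)
  obtain ⟨m, rfl⟩ := (hS _ hXb).2.2 h
  obtain ⟨n, hn⟩ := (hS _ hXa).2.1 (P.d a b ≫ m) (by
    rw [Category.assoc, hh])
  obtain ⟨r, hr⟩ := extStarVanish_iff.1 h₁ P ε hP (a - 1) a b (by omega) hab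
    (by push_cast; omega) n ((hS _ hXz).1 (by simp [hn]))
  obtain ⟨l, hl⟩ := extStarVanish_iff.1 h₂ P ε hP a b c hab hbc hb (m - r ≫ S.f) (by
    rw [Preadditive.comp_sub, ← Category.assoc _ r, hr, hn, sub_self])
  refine ⟨l ≫ S.g, ?_⟩
  rw [← Category.assoc, hl, Preadditive.sub_comp, Category.assoc, S.zero, comp_zero, sub_zero]

/-- The segment `Ext⁎¹(S.X₃, N) ⟶ Ext⁎¹(S.X₂, N) ⟶ Ext⁎¹(S.X₁, N)` of the long exact sequence. -/
theorem ExtStarVanish.extension_left (hbp : IsBalancedPair 𝒳 𝒴) {S : ShortComplex A}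
    (hS : SESLeftAcyclic 𝒴 S) {N : A} (h₁ : ExtStarVanish 𝒳 1 S.X₁ N)
    (h₃ : ExtStarVanish 𝒳 1 S.X₃ N) : ExtStarVanish 𝒳 1 S.X₂ N := by
  obtain ⟨Q, η, hQ, hQX⟩ := hbp.2.2.2 N
  refine extStarVanish_one_of_presentation fun hp =>
    hp.homExactAt_of_homCoresolution_exact hbp hQ hQX fun g hg => ?_
  obtain ⟨P₁, _, hP₁, -⟩ := hbp.2.2.1 S.X₁
  obtain ⟨P₃, _, hP₃, -⟩ := hbp.2.2.1 S.X₃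
  have hQ₀ := hS _ (hQ.2.1 0 le_rfl)
  have hQ₁ := hS _ (hQ.2.1 1 (by omega))
  have hQ₂ := hS _ (hQ.2.1 2 (by omega))
  obtain ⟨m, hm⟩ := hP₁.presentation.homCoresolution_exact hbp hQ hQX
    (h₁.homExactAt hbp hP₁.presentation) (S.f ≫ g) (by rw [Category.assoc, hg, comp_zero])
  obtain ⟨n, rfl⟩ := hQ₀.2.2 m
  obtain ⟨t, ht⟩ := hQ₁.2.1 (g - n ≫ Q.d 0 1) (by
    rw [Preadditive.comp_sub, ← Category.assoc, hm, sub_self])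
  obtain ⟨s, rfl⟩ := hP₃.presentation.homCoresolution_exact hbp hQ hQX
    (h₃.homExactAt hbp hP₃.presentation) t (hQ₂.1 (by simp [reassoc_of% ht, hg]))
  refine ⟨S.g ≫ s + n, ?_⟩
  rw [Preadditive.add_comp, Category.assoc, ht, sub_add_cancel]

/-- The segment `Ext⁎¹(S.X₂, N) ⟶ Ext⁎¹(S.X₁, N) ⟶ Ext⁎²(S.X₃, N)` of the long exact sequence. -/
theorem ExtStarVanish.kernel_left (hbp : IsBalancedPair 𝒳 𝒴) {S : ShortComplex A}
    (hS : SESLeftAcyclic 𝒴 S) {N : A} (h₂ : ExtStarVanish 𝒳 1 S.X₂ N)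
    (h₃ : ExtStarVanish 𝒳 2 S.X₃ N) : ExtStarVanish 𝒳 1 S.X₁ N := by
  obtain ⟨Q, η, hQ, hQX⟩ := hbp.2.2.2 N
  refine extStarVanish_one_of_presentation fun hp =>
    hp.homExactAt_of_homCoresolution_exact hbp hQ hQX fun g hg => ?_
  obtain ⟨P, _, hP, -⟩ := hbp.2.2.1 S.X₂
  have hQ₁ := hS _ (hQ.2.1 1 (by omega))
  have hQ₂ := hS _ (hQ.2.1 2 (by omega))
  have hQ₃ := hS _ (hQ.2.1 3 (by omega))
  obtain ⟨m, rfl⟩ := hQ₁.2.2 g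
  obtain ⟨t, ht⟩ := hQ₂.2.1 (m ≫ Q.d 1 2) (by rw [← Category.assoc, hg])
  obtain ⟨s, rfl⟩ := h₃.homCoresolution_exact_two hbp hQ hQX t
    (hQ₃.1 (by simp [reassoc_of% ht]))
  obtain ⟨l, hl⟩ := hP.presentation.homCoresolution_exact hbp hQ hQX
    (h₂.homExactAt hbp hP.presentation) (m - S.g ≫ s) (by
      rw [Preadditive.sub_comp, Category.assoc, ht, sub_self])
  refine ⟨S.f ≫ l, ?_⟩
  rw [Category.assoc, hl, Preadditive.comp_sub, ← Category.assoc, S.zero, zero_comp, sub_zero]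

/-- Dimension shifting along the start of a coresolution of `N`. -/
theorem ExtStarVanish.succ_of_cokernel (hbp : IsBalancedPair 𝒳 𝒴) {C N : A}
    {Q : CochainComplex A ℤ} {η : N ⟶ Q.X 0} (hQ : IsProperYCoresolution 𝒴 N Q η)
    (hQX : AugCoresRightAcyclic 𝒳 N Q η) {i : ℕ} (hi : 1 ≤ i)
    (H : ExtStarVanish 𝒳 i C (cokernel η)) : ExtStarVanish 𝒳 (i + 1) C N := by
  refine extStarVanish_iff.2 fun P ε hP a b c hab hbc hb h hh => ?_
  push_cast at hb
  have hXb : P.X b ∈ 𝒳 := hP.2.1 _ (by omega)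
  have hXc : P.X c ∈ 𝒳 := hP.2.1 _ (by omega)
  have hXc' : P.X (c + 1) ∈ 𝒳 := hP.2.1 _ (by omega)
  obtain ⟨m, hm⟩ := hP.homExactAt hbp hab hbc (by omega) (hQ.2.1 0 le_rfl) (h ≫ η)
    (by rw [← Category.assoc, hh, zero_comp])
  obtain ⟨n, hn⟩ := extStarVanish_iff.1 H P ε hP b c (c + 1) hbc rfl (by omega)
    (m ≫ cokernel.π η) (by
      rw [← Category.assoc, hm, Category.assoc, cokernel.condition, comp_zero])
  obtain ⟨r, hr⟩ := ((hQ.starAcyclic hbp hQX).2.1 _ hXc').2.2 n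
  obtain ⟨k, hk⟩ := (hQX _ hXc).2.1 (m - P.d c (c + 1) ≫ r) (by
    have : (m - P.d c (c + 1) ≫ r) ≫ cokernel.π η = 0 := by
      rw [Preadditive.sub_comp, Category.assoc, sub_eq_zero, ← hn]
      exact congrArg _ hr.symm
    rw [← cokernel.π_desc η _ hQ.2.2.1, ← Category.assoc, this, zero_comp])
  refine ⟨k, hQX.cancel hXb ?_⟩
  rw [Category.assoc, hk, Preadditive.comp_sub, ← Category.assoc _ _ r, P.d_comp_d, zero_comp,
    sub_zero, hm]

theorem IsRelCotorsionPair.extStarVanish_of_xResolving (hbp : IsBalancedPair 𝒳 𝒴)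
    {𝒞 𝒟 : Set A} (hcp : IsRelCotorsionPair 𝒳 𝒞 𝒟) (h𝒞 : XResolving 𝒳 𝒴 𝒞) {i : ℕ}
    (hi : 1 ≤ i) {C D : A} (hC : C ∈ 𝒞) (hD : D ∈ 𝒟) : ExtStarVanish 𝒳 i C D := by
  refine extStarVanish_iff.2 fun P ε hP a b c hab hbc hb => ?_
  obtain ⟨K, e, hK, hp⟩ := hP.exists_presentation (𝒞 := 𝒞) (fun f hf hM => by
    refine h𝒞.2.2 _ (hf.starAcyclic hbp) (h𝒞.1 hf.1) ((hcp.1 _).2 fun D hD => ?_)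
    exact extStarVanish_one_of_presentation fun hp =>
      ((hcp.1 _).1 hM D hD).homExactAt hbp (hp.comp_image hf)) hC hab hbc (by omega)
  exact ((hcp.1 K).1 hK D hD).homExactAt hbp hp

theorem IsRelCotorsionPair.extStarVanish_of_yCoresolving (hbp : IsBalancedPair 𝒳 𝒴)
    {𝒞 𝒟 : Set A} (hcp : IsRelCotorsionPair 𝒳 𝒞 𝒟) (h𝒟 : YCoresolving 𝒳 𝒴 𝒟) {i : ℕ}
    (hi : 1 ≤ i) {C D : A} (hC : C ∈ 𝒞) (hD : D ∈ 𝒟) : ExtStarVanish 𝒳 i C D := by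
  induction i, hi using Nat.le_induction generalizing D with
  | base => exact (hcp.1 C).1 hC D hD
  | succ i hi ih =>
    obtain ⟨Q, η, hQ, hQX⟩ := hbp.2.2.2 D
    refine ExtStarVanish.succ_of_cokernel hbp hQ hQX hi (ih ?_)
    exact h𝒟.2.2 _ (hQ.starAcyclic hbp hQX)
      ((hcp.2 _).2 fun C hC => ((hcp.1 C).1 hC D hD).image_right hbp hQ hQX)
      (h𝒟.1 (hQ.2.1 0 le_rfl))

theorem IsRelCotorsionPair.xResolving (hbp : IsBalancedPair 𝒳 𝒴)
    {𝒞 𝒟 : Set A} (hcp : IsRelCotorsionPair 𝒳 𝒞 𝒟)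
    (H : ∀ C ∈ 𝒞, ∀ D ∈ 𝒟, ExtStarVanish 𝒳 2 C D) : XResolving 𝒳 𝒴 𝒞 :=
  ⟨fun _ hX => (hcp.1 _).2 fun D _ => extStarVanish_one_of_mem hX D,
    fun _ hS h₁ h₃ => (hcp.1 _).2 fun D hD =>
      .extension_left hbp hS.2.2 ((hcp.1 _).1 h₁ D hD) ((hcp.1 _).1 h₃ D hD),
    fun _ hS h₂ h₃ => (hcp.1 _).2 fun D hD =>
      .kernel_left hbp hS.2.2 ((hcp.1 _).1 h₂ D hD) (H _ h₃ D hD)⟩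

theorem IsRelCotorsionPair.yCoresolving (hbp : IsBalancedPair 𝒳 𝒴)
    {𝒞 𝒟 : Set A} (hcp : IsRelCotorsionPair 𝒳 𝒞 𝒟)
    (H : ∀ C ∈ 𝒞, ∀ D ∈ 𝒟, ExtStarVanish 𝒳 2 C D) : YCoresolving 𝒳 𝒴 𝒟 :=
  ⟨fun _ hY => (hcp.2 _).2 fun C _ => extStarVanish_of_mem_right hbp le_rfl C hY,
    fun _ hS h₁ h₃ => (hcp.2 _).2 fun C hC =>
      .extension_right hS.2.1 le_rfl ((hcp.2 _).1 h₁ C hC) ((hcp.2 _).1 h₃ C hC),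
    fun _ hS h₁ h₂ => (hcp.2 _).2 fun C hC =>
      .cokernel_right hS.2.1 le_rfl ((hcp.2 _).1 h₂ C hC) (H C hC _ h₁)⟩

end Helpers

theorem stmt7 (𝒳 𝒴 𝒞 𝒟 : Set A) (hbp : IsBalancedPair 𝒳 𝒴)
    (hcp : IsRelCotorsionPair 𝒳 𝒞 𝒟) :
    [XResolving 𝒳 𝒴 𝒞, YCoresolving 𝒳 𝒴 𝒟,
      ∀ i : ℕ, 1 ≤ i → ∀ C ∈ 𝒞, ∀ D ∈ 𝒟, ExtStarVanish 𝒳 i C D].TFAE := by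
  tfae_have 1 → 3 := fun h _ hi _ hC _ hD => hcp.extStarVanish_of_xResolving hbp h hi hC hD
  tfae_have 2 → 3 := fun h _ hi _ hC _ hD => hcp.extStarVanish_of_yCoresolving hbp h hi hC hD
  tfae_have 3 → 1 := fun h => hcp.xResolving hbp (h 2 (by omega))
  tfae_have 3 → 2 := fun h => hcp.yCoresolving hbp (h 2 (by omega))
  tfae_finish

end stmt7
end

section
/- Let A be a finite-dimensional algebra over a field k. Then the injective dimension of A as a left A-module is finite if and only if, inside the bounded derived category D^b(mod A), every bounded complex of finitely generated projective modules is isomorphic to a bounded complex of finitely generated injective modules (K^b(proj A) ⊆ K^b(inj A)). -/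
open CategoryTheory Limits

section
variable {C : Type*} [Category* C] [Abelian C]

namespace CochainComplex
open HomologicalComplex

/-- A monomorphism of cochain complexes with acyclic cokernel is a quasi-isomorphism. -/
lemma quasiIso_of_shortExact_of_acyclic {S : ShortComplex (CochainComplex C ℤ)}
    (hS : S.ShortExact) (h₃ : S.X₃.Acyclic) : QuasiIso S.f := by
  rw [quasiIso_iff]
  intro i
  rw [quasiIsoAt_iff_isIso_homologyMap]
  have h (j : ℤ) : IsZero (S.X₃.homology j) := (h₃ j).isZero_homology
  have : Epi (homologyMap S.f i) := (hS.homology_exact₂ i).epi_f ((h i).eq_of_tgt _ _)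
  have : Mono (homologyMap S.f i) :=
    (hS.homology_exact₁ (i - 1) i (by simp)).mono_g ((h (i - 1)).eq_of_src _ _)
  exact isIso_of_mono_of_epi _

lemma acyclic_double_id (X : C) (m : ℤ) :
    (double (𝟙 X) (show (ComplexShape.up ℤ).Rel m (m + 1) by simp)).Acyclic := by
  have hr : (ComplexShape.up ℤ).Rel m (m + 1) := by simp
  have hm : m ≠ m + 1 := by lia
  intro i
  let K := double (𝟙 X) hr
  change K.ExactAt i
  have hd : IsIso (K.d m (m + 1)) := by
    rw [double_d _ _ hm]; infer_instance
  rw [K.exactAt_iff' (i - 1) i (i + 1) (by simp) (by simp)]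
  by_cases h₀ : i = m
  · subst h₀
    have h : IsZero (K.X (i - 1)) := isZero_double_X _ _ _ (by lia) (by lia)
    rw [ShortComplex.exact_iff_mono _ (h.eq_of_src _ _)]
    exact inferInstanceAs (Mono (K.d i (i + 1)))
  by_cases h₁ : i = m + 1
  · have h : IsZero (K.X (i + 1)) := isZero_double_X _ _ _ (by lia) (by lia)
    rw [ShortComplex.exact_iff_epi _ (h.eq_of_tgt _ _)]
    subst h₁
    have h' : m + 1 - 1 = m := by lia
    change Epi (K.d (m + 1 - 1) (m + 1))
    rw [h']
    infer_instance
  · exact ShortComplex.exact_of_isZero_X₂ _ (isZero_double_X (𝟙 X) hr i h₀ h₁)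

/-- A monomorphism `K.X m ⟶ E` extends to a quasi-isomorphism out of `K` which replaces `K.X m`
by `E` and only changes the degrees `m` and `m + 1`. -/
lemma exists_quasiIso_replacing_X (K : CochainComplex C ℤ) (m : ℤ) {E : C} (ι : K.X m ⟶ E)
    [Mono ι] :
    ∃ (L : CochainComplex C ℤ) (f : K ⟶ L), QuasiIso f ∧ Mono f ∧
      (∀ i, i ≠ m → i ≠ m + 1 → IsIso (f.f i)) ∧ Nonempty (L.X m ≅ E) ∧
      Nonempty (cokernel (f.f (m + 1)) ≅ cokernel ι) := by
  have hr : (ComplexShape.up ℤ).Rel m (m + 1) := by simp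
  have hm : m ≠ m + 1 := by lia
  let T : double (𝟙 (K.X m)) hr ⟶ double (𝟙 E) hr :=
    mkHomFromDouble hr hm (ι ≫ (doubleXIso₀ (𝟙 E) hr).inv) (ι ≫ (doubleXIso₁ (𝟙 E) hr hm).inv)
      (by simp [double_d _ _ hm]) (fun k hk ↦ by
        rw [double_d_eq_zero₀ _ _ _ _ hm.symm, comp_zero])
  let g : double (𝟙 (K.X m)) hr ⟶ K :=
    mkHomFromDouble hr hm (𝟙 _) (K.d m (m + 1)) (by simp) (by simp)
  have hTm : T.f m = (doubleXIso₀ _ hr).hom ≫ ι ≫ (doubleXIso₀ (𝟙 E) hr).inv := by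
    simp [T]
  have hTm' : T.f (m + 1) = (doubleXIso₁ _ hr hm).hom ≫ ι ≫ (doubleXIso₁ (𝟙 E) hr hm).inv := by
    simp [T]
  have hT : Mono T := by
    apply mono_of_mono_f
    intro i
    by_cases h₀ : i = m
    · subst h₀; rw [hTm]; infer_instance
    by_cases h₁ : i = m + 1
    · subst h₁; rw [hTm']; infer_instance
    · exact ⟨fun _ _ _ ↦ (isZero_double_X _ _ _ h₀ h₁).eq_of_tgt _ _⟩
  have sq := IsPushout.of_hasPushout T g
  have sqi (i : ℤ) : IsPushout (T.f i) (g.f i) ((pushout.inl T g).f i) ((pushout.inr T g).f i) :=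
    sq.map (eval C (ComplexShape.up ℤ) i)
  refine ⟨pushout T g, pushout.inr T g, ?_, inferInstance, ?_, ?_, ?_⟩
  · have h₁ : (ShortComplex.mk _ _ (cokernel.condition T)).ShortExact :=
      { exact := ShortComplex.exact_cokernel T }
    have h₂ : (ShortComplex.mk _ _ (cokernel.condition (pushout.inr T g))).ShortExact :=
      { exact := ShortComplex.exact_cokernel _ }
    have hqT : QuasiIso T := by
      rw [quasiIso_iff]
      intro i
      rw [quasiIsoAt_iff_exactAt _ _ (acyclic_double_id _ _ i)]
      exact acyclic_double_id _ _ i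
    have := isIso_cokernel_map_of_isPushout sq
    exact quasiIso_of_shortExact_of_acyclic h₂
      (fun i ↦ (h₁.acyclic_X₃ hqT i).of_iso (asIso (cokernel.map _ _ _ _ sq.w)))
  · intro i h₀ h₁
    have : IsIso (T.f i) := (isZero_double_X _ _ _ h₀ h₁).isIso (isZero_double_X _ _ _ h₀ h₁) _
    exact (sqi i).isIso_inr_of_isIso
  · have : IsIso (g.f m) := by
      rw [show g.f m = (doubleXIso₀ (𝟙 (K.X m)) hr).hom by simp [g]]
      infer_instance
    have := (sqi m).isIso_inl_of_isIso
    exact ⟨(asIso ((pushout.inl T g).f m)).symm ≪≫ doubleXIso₀ _ hr⟩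
  · have := isIso_cokernel_map_of_isPushout (sqi (m + 1))
    exact ⟨(asIso (cokernel.map _ _ _ _ (sqi (m + 1)).w)).symm ≪≫
      cokernel.mapIso _ _ (doubleXIso₁ (𝟙 _) hr hm) (doubleXIso₁ (𝟙 E) hr hm) (by simp [hTm'])⟩

/-- A bounded below complex whose terms have injective dimension bounded in terms of the degree is
quasi-isomorphic to a bounded complex of injectives, all of whose terms lie in a class `P` with
enough injectives as soon as those of the original complex do. -/
lemma exists_quasiIso_injective (P : ObjectProperty C) [P.IsClosedUnderExtensions]
    [P.IsClosedUnderQuotients]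
    (hP : ∀ X, P X → ∃ (E : C) (ι : X ⟶ E), P E ∧ Injective E ∧ Mono ι)
    (a c : ℤ) (n : ℕ) (m : ℤ) (hm : c - m = n + 1) (ha : a ≤ m)
    (K : CochainComplex C ℤ) (hK : ∀ i, P (K.X i)) (hK₀ : ∀ i < a, IsZero (K.X i))
    (hKlt : ∀ i < m, Injective (K.X i))
    (hKge : ∀ i, m ≤ i → HasInjectiveDimensionLT (K.X i) (c - i).toNat) :
    ∃ (L : CochainComplex C ℤ) (f : K ⟶ L), QuasiIso f ∧
      (∀ i, Injective (L.X i) ∧ P (L.X i)) ∧ ∀ i, i < a ∨ c ≤ i → IsZero (L.X i) := by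
  induction n generalizing m K with
  | zero =>
    refine ⟨K, 𝟙 K, inferInstance, fun i ↦ ⟨?_, hK i⟩, ?_⟩
    · by_cases hi : i < m
      · exact hKlt i hi
      · have := hKge i (by lia)
        have := hasInjectiveDimensionLT_of_ge (K.X i) (c - i).toNat 1 (by lia)
        infer_instance
    · rintro i (hi | hi)
      · exact hK₀ i hi
      · have := hKge i (by lia)
        rw [show (c - i).toNat = 0 by lia] at this
        exact isZero_of_hasInjectiveDimensionLT_zero _
  | succ n ih =>
    obtain ⟨E, ι, hE, _, _⟩ := hP _ (hK m)
    obtain ⟨L, f, _, _, hf, ⟨e⟩, ⟨e'⟩⟩ := K.exists_quasiIso_replacing_X m ι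
    have hf' (i : ℤ) (h₀ : i ≠ m) (h₁ : i ≠ m + 1) : Nonempty (K.X i ≅ L.X i) := by
      have := hf i h₀ h₁
      exact ⟨asIso (f.f i)⟩
    have hS₁ : (ShortComplex.mk _ _ (cokernel.condition ι)).ShortExact :=
      { exact := ShortComplex.exact_cokernel _ }
    have hS₂ : (ShortComplex.mk _ _ (cokernel.condition (f.f (m + 1)))).ShortExact :=
      { exact := ShortComplex.exact_cokernel _ }
    obtain ⟨M, g, _, hM, hM'⟩ := ih (m + 1) (by lia) (by lia) L (fun i ↦ by
        by_cases h₀ : i = m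
        · subst h₀
          exact P.prop_of_iso e.symm hE
        by_cases h₁ : i = m + 1
        · subst h₁
          exact P.prop_X₂_of_shortExact hS₂ (hK _)
            (P.prop_of_iso e'.symm (P.prop_of_epi (cokernel.π ι) hE))
        · obtain ⟨e⟩ := hf' i h₀ h₁
          exact P.prop_of_iso e (hK i)) (fun i hi ↦ by
        obtain ⟨e⟩ := hf' i (by lia) (by lia)
        exact (hK₀ i hi).of_iso e.symm) (fun i hi ↦ by
        by_cases h₀ : i = m
        · subst h₀
          exact Injective.of_iso e.symm inferInstance
        · obtain ⟨e⟩ := hf' i (by lia) (by lia)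
          exact Injective.of_iso e (hKlt i (by lia))) (fun i hi ↦ by
        by_cases h₁ : i = m + 1
        · subst h₁
          rw [show (c - (m + 1)).toNat = n + 1 by lia]
          refine hS₂.hasInjectiveDimensionLT_X₂ _ ?_ ?_
          · simpa only [show (c - (m + 1)).toNat = n + 1 by lia] using hKge (m + 1) (by lia)
          · have : HasInjectiveDimensionLT (cokernel ι) (n + 1) :=
              hS₁.hasInjectiveDimensionLT_X₃ _ (inferInstanceAs (HasInjectiveDimensionLT E (n + 1)))
                (by simpa only [show (c - m).toNat = n + 1 + 1 by lia] using hKge m (by lia))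
            exact hasInjectiveDimensionLT_of_iso e'.symm _
        · obtain ⟨e⟩ := hf' i (by lia) (by lia)
          have := hKge i (by lia)
          exact hasInjectiveDimensionLT_of_iso e _)
    exact ⟨M, f ≫ g, inferInstance, hM, hM'⟩

/-- A bounded complex of injectives with cohomology in nonnegative degrees is quasi-isomorphic to
one concentrated in nonnegative degrees. -/
lemma exists_quasiIso_injective_isStrictlyGE_zero (b : ℤ) (n : ℕ) (K : CochainComplex C ℤ)
    [K.IsStrictlyGE (-n)] [K.IsStrictlyLE b] [K.IsGE 0] (hK : ∀ i, Injective (K.X i)) :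
    ∃ (L : CochainComplex C ℤ) (f : K ⟶ L), QuasiIso f ∧ (∀ i, Injective (L.X i)) ∧
      L.IsStrictlyGE 0 ∧ L.IsStrictlyLE b := by
  induction n generalizing K with
  | zero => exact ⟨K, 𝟙 K, inferInstance, hK, by simpa using ‹K.IsStrictlyGE _›, inferInstance⟩
  | succ n ih =>
    have := K.isGE_of_ge (-n) 0 (by lia)
    have hinj (i : ℤ) : Injective ((K.truncGE (-n)).X i) := by
      rcases lt_trichotomy i (-n) with hi | rfl | hi
      · exact (isZero_of_isStrictlyGE _ (-n : ℤ) i).injective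
      · exact Injective.of_iso (K.truncGEXIsoOpcycles _).symm
          (K.injective_opcycles (-(n + 1 : ℕ)) _ (K.exactAt_of_isGE 0 _) (by lia))
      · exact Injective.of_iso (K.truncGEXIso (-n) i hi).symm (hK i)
    have : (K.truncGE (-n)).IsGE 0 := by
      rw [isGE_iff]
      intro i hi
      rw [← quasiIsoAt_iff_exactAt (K.πTruncGE (-n)) i (K.exactAt_of_isGE 0 i)]
      infer_instance
    obtain ⟨L, f, _, hL⟩ := ih (K.truncGE (-n)) hinj
    exact ⟨L, K.πTruncGE (-n) ≫ f, inferInstance, hL⟩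

/-- An exact sequence `0 ⟶ X ⟶ Y ⟶ Z ⟶ W` induces a short exact sequence
`0 ⟶ X ⟶ Y ⟶ ker (Z ⟶ W) ⟶ 0`. -/
lemma _root_.CategoryTheory.ShortComplex.shortExact_kernelLift {X Y Z W : C} (f : X ⟶ Y)
    (g : Y ⟶ Z) (h : Z ⟶ W) (w₁ : f ≫ g = 0) (w₂ : g ≫ h = 0) [Mono f]
    (h₁ : (ShortComplex.mk f g w₁).Exact) (h₂ : (ShortComplex.mk g h w₂).Exact) :
    (ShortComplex.mk f (kernel.lift h g w₂) (by simp [← cancel_mono (kernel.ι h), w₁])).ShortExact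
    where
  exact := by
    let φ : ShortComplex.mk f (kernel.lift h g w₂) (by simp [← cancel_mono (kernel.ι h), w₁]) ⟶
      ShortComplex.mk f g w₁ := { τ₁ := 𝟙 _, τ₂ := 𝟙 _, τ₃ := kernel.ι h }
    have : Epi φ.τ₁ := inferInstanceAs (Epi (𝟙 X))
    have : IsIso φ.τ₂ := inferInstanceAs (IsIso (𝟙 Y))
    have : Mono φ.τ₃ := inferInstanceAs (Mono (kernel.ι h))
    exact (ShortComplex.exact_iff_of_epi_of_isIso_of_mono φ).2 h₁
  epi_g := (ShortComplex.exact_iff_epi_kernel_lift _).1 h₂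

/-- An object with an injective coresolution of length `n` has injective dimension at most `n`. -/
lemma hasInjectiveDimensionLT_of_coresolution (n : ℕ) (Q : CochainComplex C ℤ) {X : C}
    (η : X ⟶ Q.X 0) (w : η ≫ Q.d 0 1 = 0) (h₀ : ∀ i : ℤ, n < i → IsZero (Q.X i))
    (hQ : ∀ i : ℤ, 0 ≤ i → Injective (Q.X i)) [Mono η] (hη : (ShortComplex.mk η (Q.d 0 1) w).Exact)
    (hd : ∀ i : ℤ, 1 ≤ i →
      (ShortComplex.mk (Q.d (i - 1) i) (Q.d i (i + 1)) (Q.d_comp_d _ _ _)).Exact) :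
    HasInjectiveDimensionLT X (n + 1) := by
  have hd' (i j k : ℤ) (hij : i + 1 = j) (hjk : j + 1 = k) (hj : 1 ≤ j) :
      (ShortComplex.mk (Q.d i j) (Q.d j k) (Q.d_comp_d _ _ _)).Exact := by
    obtain rfl : i = j - 1 := by lia
    subst hjk
    exact hd j hj
  have hker (k : ℕ) (i j : ℤ) (hij : i + 1 = j) (hi : 0 ≤ i) (hk : i + k = n + 1) :
      HasInjectiveDimensionLT (kernel (Q.d i j)) k := by
    induction k generalizing i j with
    | zero =>
      exact ((h₀ i (by lia)).of_mono (kernel.ι (Q.d i j))).hasInjectiveDimensionLT_zero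
    | succ k ih =>
      have := hQ i hi
      exact (ShortComplex.shortExact_kernelLift _ _ _ _ _ (ShortComplex.exact_kernel (Q.d i j))
        (hd' i j (j + 1) hij rfl (by lia))).hasInjectiveDimensionLT_X₁ k
        (ih j (j + 1) rfl (by lia) (by lia)) (inferInstanceAs (HasInjectiveDimensionLT (Q.X i) _))
  have := hQ 0 le_rfl
  exact (ShortComplex.shortExact_kernelLift _ _ _ _ _ hη
    (hd' 0 1 2 rfl rfl le_rfl)).hasInjectiveDimensionLT_X₁ n
      (hker n 1 2 rfl (by lia) (by lia)) (inferInstanceAs (HasInjectiveDimensionLT (Q.X 0) _))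

/-- A quasi-isomorphism from an object placed in degree `0` to a complex concentrated in
nonnegative degrees is a coresolution of that object. -/
lemma mono_and_exact_of_quasiIso_single {X : C} {Q : CochainComplex C ℤ}
    (φ : (single C (ComplexShape.up ℤ) 0).obj X ⟶ Q) [QuasiIso φ] (hQ : IsZero (Q.X (-1))) :
    ∃ (η : X ⟶ Q.X 0) (w : η ≫ Q.d 0 1 = 0), Mono η ∧ (ShortComplex.mk η (Q.d 0 1) w).Exact := by
  let e := singleObjXSelf (ComplexShape.up ℤ) 0 X
  have w : φ.f 0 ≫ Q.d 0 1 = 0 := by simp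
  have hφ := (quasiIsoAt_iff' φ (-1) 0 1 (by simp) (by simp)).1 inferInstance
  have hd (i j : ℤ) : ((single C (ComplexShape.up ℤ) 0).obj X).d i j = 0 := single_obj_d ..
  have h : (ShortComplex.mk (φ.f 0) (Q.d 0 1) w).Exact ∧ Mono (φ.f 0) :=
    (ShortComplex.quasiIso_iff_of_zeros _ (hd _ _) (hd _ _) (hQ.eq_of_src _ _)).1 hφ
  have w' : (e.inv ≫ φ.f 0) ≫ Q.d 0 1 = 0 := by rw [Category.assoc, w, comp_zero]
  exact ⟨e.inv ≫ φ.f 0, w', ((ShortComplex.exact_and_mono_f_iff_of_iso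
    (ShortComplex.isoMk e (Iso.refl _) (Iso.refl _) (by simp [e]) (by simp) :
      ShortComplex.mk (φ.f 0) (Q.d 0 1) w ≅ ShortComplex.mk (e.inv ≫ φ.f 0) (Q.d 0 1) w')).1
    h).symm⟩

end CochainComplex
end

universe u

namespace ModuleCat

section
variable {R : Type*} [Ring R]

instance isClosedUnderQuotients_isFG : (ModuleCat.isFG R).IsClosedUnderQuotients where
  prop_of_epi f _ hX := by
    rw [isFG_iff] at hX ⊢
    exact Module.Finite.of_surjective f.hom ((ModuleCat.epi_iff_surjective f).1 inferInstance)

instance isClosedUnderExtensions_isFG : (ModuleCat.isFG R).IsClosedUnderExtensions where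
  prop_X₂_of_shortExact {S} hS h₁ h₃ := by
    rw [isFG_iff] at h₁ h₃ ⊢
    exact Module.Finite.of_exact
      ((ShortComplex.ShortExact.moduleCat_exact_iff_function_exact S).1 hS.exact)
      hS.moduleCat_surjective_g

end

section
variable (k : Type*) [Field k] {A : Type*} [Ring A] [Algebra k A] [FiniteDimensional k A]

/-- Over a finite-dimensional algebra, coextension of scalars sends finite-dimensional vector
spaces to finitely generated modules. -/
lemma finite_coextendScalars_obj (V : ModuleCat k) [Module.Finite k V] :
    Module.Finite A ((coextendScalars (algebraMap k A)).obj V) := by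
  have hA : Module.Finite k ((restrictScalars (algebraMap k A)).obj (of A A)) := by
    let e : A →ₗ[k] (restrictScalars (algebraMap k A)).obj (of A A) :=
      { toFun := fun a ↦ a, map_add' := fun _ _ ↦ rfl, map_smul' := Algebra.smul_def }
    exact Module.Finite.of_surjective e fun a ↦ ⟨a, rfl⟩
  obtain ⟨s, hs⟩ : (⊤ : Submodule k
    ((restrictScalars (algebraMap k A)).obj (of A A) →ₗ[k] V)).FG := Module.Finite.fg_top
  refine Module.Finite.of_surjective (M := (restrictScalars (algebraMap k A)).obj (of A A) →ₗ[k] V)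
    (hM := ⟨s, ?_⟩) (CoextendScalars.equiv (algebraMap k A) V).symm.toLinearMap
    (CoextendScalars.equiv (algebraMap k A) V).symm.surjective
  rw [eq_top_iff]
  rintro x -
  have hx : x ∈ Submodule.span k (s : Set _) := hs ▸ Submodule.mem_top
  induction hx using Submodule.span_induction with
  | mem x hx => exact Submodule.subset_span hx
  | zero => exact zero_mem _
  | add x y _ _ hx hy => exact add_mem hx hy
  | smul c x _ hx =>
    have : c • x = algebraMap k A c • x := by
      refine LinearMap.ext fun (a : A) ↦ ?_
      refine Eq.trans ?_ (congrArg x (Algebra.commutes c a))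
      exact (x.map_smul c a).symm
    rw [this]
    exact Submodule.smul_mem _ _ hx

end

/-- Finitely generated modules over a finite-dimensional algebra embed into finitely generated
injective modules. -/
lemma exists_injective_mono_of_isFG (k : Type u) [Field k] {A : Type u} [Ring A] [Algebra k A]
    [FiniteDimensional k A] (M : ModuleCat.{u} A) (hM : isFG A M) :
    ∃ (E : ModuleCat.{u} A) (ι : M ⟶ E), isFG A E ∧ Injective E ∧ Mono ι := by
  let f := algebraMap k A
  let V := (restrictScalars f).obj M
  have hV : Module.Finite k V := by
    rw [isFG_iff] at hM
    let : Module k M := Module.compHom M f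
    have : IsScalarTower k A M := ⟨fun c a m ↦ by
      rw [Algebra.smul_def, mul_smul]; rfl⟩
    exact Module.Finite.trans (R := k) A M
  have : Injective V :=
    have := Module.injective_of_isSemisimpleRing k V
    Module.injective_object_of_injective_module k V
  have adj := restrictCoextendScalarsAdj.{u, u, u} f
  exact ⟨(coextendScalars f).obj V, adj.unit.app M, finite_coextendScalars_obj k V,
    Injective.injective_of_adjoint adj V, inferInstance⟩

section
variable {R : Type u} [Ring R] (d : ℕ) [HasInjectiveDimensionLT (of R R) d]

/-- Finite free modules inherit bounds on the injective dimension of the ring. -/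
lemma hasInjectiveDimensionLT_pi (n : ℕ) : HasInjectiveDimensionLT (of R (Fin n → R)) d := by
  induction n with
  | zero =>
    have h : IsZero (of R (Fin 0 → R)) := isZero_of_subsingleton _
    have := h.hasInjectiveDimensionLT_zero
    exact hasInjectiveDimensionLT_of_ge _ 0 d (Nat.zero_le d)
  | succ n ih =>
    exact hasInjectiveDimensionLT_of_iso (biprodIsoProd (of R R) (of R (Fin n → R)) ≪≫
      (Fin.consLinearEquiv R fun _ : Fin (n + 1) ↦ R).toModuleIso) d

/-- Finitely generated projective modules inherit bounds on the injective dimension of the ring. -/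
lemma hasInjectiveDimensionLT_of_projective (M : ModuleCat.{u} R) [Projective M]
    [Module.Finite R M] : HasInjectiveDimensionLT M d := by
  obtain ⟨n, g, hg⟩ := Module.Finite.exists_fin' R M
  have : Epi (ofHom g) := (epi_iff_surjective _).2 hg
  have := hasInjectiveDimensionLT_pi (R := R) d n
  exact Retract.hasInjectiveDimensionLT (Y := of R (Fin n → R))
    ⟨Projective.factorThru (𝟙 M) (ofHom g), ofHom g, Projective.factorThru_comp _ _⟩ d

end
end ModuleCat

/-- for a finite-dimensional algebra `A` over a field `k`, the injective
dimension of `A` as a left `A`-module is finite iff every bounded complex of finitely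
generated projective `A`-modules is quasi-isomorphic to a bounded complex of finitely
generated injective `A`-modules (i.e. `K^b(proj A) ⊆ K^b(inj A)` in `D^b(mod A)`). -/
theorem stmt18 (k : Type) [Field k] (A : Type) [Ring A] [Algebra k A]
    [FiniteDimensional k A] :
    (∃ (n : ℕ) (Q : CochainComplex (ModuleCat.{0} A) ℤ)
        (η : ModuleCat.of A A ⟶ Q.X 0) (w : η ≫ Q.d 0 1 = 0),
        (∀ i : ℤ, i < 0 ∨ (n : ℤ) < i → IsZero (Q.X i)) ∧
        (∀ i : ℤ, 0 ≤ i → Injective (Q.X i)) ∧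
        Mono η ∧ (ShortComplex.mk η (Q.d 0 1) w).Exact ∧
        (∀ i : ℤ, 1 ≤ i →
          (ShortComplex.mk (Q.d (i - 1) i) (Q.d i (i + 1)) (Q.d_comp_d _ _ _)).Exact)) ↔
      (∀ P : CochainComplex (ModuleCat.{0} A) ℤ,
        (∃ a b : ℤ, ∀ i : ℤ, i < a ∨ b < i → IsZero (P.X i)) →
        (∀ i : ℤ, Projective (P.X i) ∧ Module.Finite A (P.X i)) →
        ∃ I : CochainComplex (ModuleCat.{0} A) ℤ,
          (∃ a b : ℤ, ∀ i : ℤ, i < a ∨ b < i → IsZero (I.X i)) ∧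
          (∀ i : ℤ, Injective (I.X i) ∧ Module.Finite A (I.X i)) ∧
          ∃ f : P ⟶ I, QuasiIso f) := by
  constructor
  · rintro ⟨n, Q, η, w, h₀, hQ, _, hη, hd⟩ P ⟨a, b, hP₀⟩ hP
    have hA : HasInjectiveDimensionLT (ModuleCat.of A A) (n + 1) :=
      CochainComplex.hasInjectiveDimensionLT_of_coresolution n Q η w
        (fun i hi ↦ h₀ i (Or.inr hi)) hQ hη hd
    obtain ⟨c, hac, hbc⟩ : ∃ c : ℤ, a + 1 ≤ c ∧ b + 1 + (n + 1) ≤ c :=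
      ⟨_, le_max_left _ _, le_max_right _ _⟩
    obtain ⟨L, f, hf, hL, hL₀⟩ := CochainComplex.exists_quasiIso_injective (ModuleCat.isFG A)
      (ModuleCat.exists_injective_mono_of_isFG k) a c (c - a - 1).toNat a (by lia) le_rfl P
      (fun i ↦ (hP i).2) (fun i hi ↦ hP₀ i (Or.inl hi))
      (fun i hi ↦ (hP₀ i (Or.inl hi)).injective) (fun i hi ↦ by
        by_cases hib : b < i
        · have := (hP₀ i (Or.inr hib)).hasInjectiveDimensionLT_zero
          exact hasInjectiveDimensionLT_of_ge _ 0 _ (Nat.zero_le _)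
        · obtain ⟨_, _⟩ := hP i
          have := ModuleCat.hasInjectiveDimensionLT_of_projective (n + 1) (P.X i)
          exact hasInjectiveDimensionLT_of_ge _ (n + 1) _ (by lia))
    exact ⟨L, ⟨a, c - 1, fun i hi ↦ hL₀ i (by lia)⟩, hL, f, hf⟩
  · intro h
    let P := (HomologicalComplex.single (ModuleCat.{0} A) (ComplexShape.up ℤ) 0).obj
      (ModuleCat.of A A)
    have hP₀ (i : ℤ) (hi : i ≠ 0) : IsZero (P.X i) :=
      HomologicalComplex.isZero_single_obj_X _ _ _ _ hi
    obtain ⟨I, ⟨a, b, hI₀⟩, hI, f, _⟩ := h P ⟨0, 0, fun i hi ↦ hP₀ i (by lia)⟩ (fun i ↦ by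
      by_cases hi : i = 0
      · subst hi
        let e : P.X 0 ≅ ModuleCat.of A A :=
          HomologicalComplex.singleObjXSelf (ComplexShape.up ℤ) 0 (ModuleCat.of A A)
        have : Projective (ModuleCat.of A A) :=
          ModuleCat.projective_of_free (Module.Basis.singleton Unit A)
        exact ⟨Projective.of_iso e.symm inferInstance,
          Module.Finite.equiv e.symm.toLinearEquiv⟩
      · have := ModuleCat.subsingleton_of_isZero (hP₀ i hi)
        exact ⟨(hP₀ i hi).projective, inferInstance⟩)
    have hPexact (i : ℤ) (hi : i ≠ 0) : P.ExactAt i :=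
      HomologicalComplex.exactAt_single_obj _ _ _ _ hi
    have : I.IsStrictlyGE (-(-a).toNat) :=
      (I.isStrictlyGE_iff _).2 fun i hi ↦ hI₀ i (by lia)
    have : I.IsStrictlyLE b.toNat :=
      (I.isStrictlyLE_iff _).2 fun i hi ↦ hI₀ i (by lia)
    have : I.IsGE 0 := (I.isGE_iff _).2 fun i hi ↦
      (quasiIsoAt_iff_exactAt f i (hPexact i hi.ne)).1 inferInstance
    obtain ⟨Q, g, _, hQ, _, _⟩ :=
      I.exists_quasiIso_injective_isStrictlyGE_zero b.toNat (-a).toNat fun i ↦ (hI i).1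
    obtain ⟨η, w, hη, hη'⟩ := CochainComplex.mono_and_exact_of_quasiIso_single (f ≫ g)
      (Q.isZero_of_isStrictlyGE 0 (-1))
    refine ⟨b.toNat, Q, η, w, fun i hi ↦ ?_, fun i _ ↦ hQ i, hη, hη', fun i hi ↦ ?_⟩
    · obtain hi | hi := hi
      · exact Q.isZero_of_isStrictlyGE 0 i
      · exact Q.isZero_of_isStrictlyLE b.toNat i
    · exact (Q.exactAt_iff' (i - 1) i (i + 1) (by simp) (by simp)).1
        ((quasiIsoAt_iff_exactAt (f ≫ g) i (hPexact i (by lia))).1 inferInstance)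
end
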